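/- arXiv:1201.2015 — 5 statements merged into one kernel-verified Lean document; each statement's English description precedes it below -/
import Mathlib

section
/- Let α ∈ (0, π/2) and define φ_α(z) = (1/2)sin²α · Log((1+z)/(1−z)) + z·cos²α/(1+z²) for z ∈ 𝔻. Then φ_α is injective on 𝔻 and φ_α(𝔻) = ℂ \ (L₋ ∪ L₊), where L₋ = { x ± (π sin²α/4)i : x ≤ −(1/2)sin²α·log(cot(α/2)) − (cos α)/2 } and L₊ = { x ± (π sin²α/4)i : x ≥ (1/2)sin²α·log(cot(α/2)) + (cos α)/2 }. In particular φ_α(𝔻) is convex in the horizontal direction. -/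
open Complex Set
open scoped Real

noncomputable section

/-- The open unit disk in the complex plane. -/
def unitDisk : Set ℂ := Metric.ball 0 1

/-- A set is convex in the horizontal direction (CHD) if its intersection with
every horizontal line is connected (possibly empty). -/
def IsCHD (Ω : Set ℂ) : Prop := ∀ t : ℝ, IsPreconnected {z | z ∈ Ω ∧ z.im = t}

/-- Integral of `f` along the line segment from `0` to `z`. -/
def segInt (f : ℂ → ℂ) (z : ℂ) : ℂ := ∫ t in (0:ℝ)..1, z * f ((t : ℂ) * z)

/-- Pochhammer symbol `(a)_m = a (a+1) ⋯ (a+m-1)`. -/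
def poch (a : ℂ) (m : ℕ) : ℂ := ∏ i ∈ Finset.range m, (a + i)

/-- Appell's first hypergeometric function `F₁(a, b₁, b₂; c; x, y)`. -/
def appellF1 (a b₁ b₂ c x y : ℂ) : ℂ :=
  ∑' (k : ℕ) (l : ℕ),
    poch a (k + l) * poch b₁ k * poch b₂ l /
      (poch c (k + l) * (Nat.factorial k : ℂ) * (Nat.factorial l : ℂ)) * x ^ k * y ^ l

theorem sinh_le_mul_cosh {x : ℝ} (hx : 0 ≤ x) : Real.sinh x ≤ x * Real.cosh x := by
  have hd : ∀ y : ℝ, HasDerivAt (fun t : ℝ => t * Real.cosh t - Real.sinh t)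
      (y * Real.sinh y) y := by
    intro y
    exact (((hasDerivAt_id' y).mul (Real.hasDerivAt_cosh y)).sub
      (Real.hasDerivAt_sinh y)).congr_deriv (by ring)
  have hm : MonotoneOn (fun t : ℝ => t * Real.cosh t - Real.sinh t) (Set.Ici 0) := by
    refine monotoneOn_of_deriv_nonneg (convex_Ici 0)
      (fun y _ => (hd y).continuousAt.continuousWithinAt)
      (fun y _ => (hd y).differentiableAt.differentiableWithinAt) fun y hy => ?_
    rw [interior_Ici, Set.mem_Ioi] at hy
    rw [(hd y).deriv]
    exact mul_nonneg hy.le (Real.sinh_nonneg_iff.2 hy.le)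
  have := hm Set.self_mem_Ici hx hx
  simp at this
  linarith

theorem cosh_add_cosh_add_sinh_div_ne_of_lt_half_pi {K a b p q : ℝ} (hK : 0 < K)
    (ha : 0 ≤ a) (hb : 0 < b) (hb' : b < π / 2) (hq : |q| + b ≤ π)
    (h₁ : Real.cosh p * Real.cos q + Real.cosh a * Real.cos b +
      K * (a * Real.sinh a * Real.cos b + b * Real.cosh a * Real.sin b) = 0)
    (h₂ : Real.sinh p * Real.sin q + Real.sinh a * Real.sin b +
      K * (a * Real.cosh a * Real.sin b - b * Real.sinh a * Real.cos b) = 0) : False := by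
  have hcq : -Real.cos b ≤ Real.cos q := by
    rw [← Real.cos_pi_sub, ← Real.cos_abs q]
    exact Real.cos_le_cos_of_nonneg_of_le_pi (abs_nonneg q) (by linarith) (by linarith)
  have hcb : 0 < Real.cos b := Real.cos_pos_of_mem_Ioo ⟨by linarith, hb'⟩
  have hsb : 0 < Real.sin b := Real.sin_pos_of_pos_of_lt_pi hb (by linarith)
  have hsb_le : Real.sin b ≤ b := Real.sin_le hb.le
  have hcb_le : Real.cos b ≤ 1 := Real.cos_le_one b
  have hbcb : b * Real.cos b ≤ Real.sin b := by
    have := Real.le_tan hb.le hb'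
    rwa [Real.tan_eq_sin_div_cos, le_div_iff₀ hcb] at this
  have hSa : 0 ≤ Real.sinh a := Real.sinh_nonneg_iff.2 ha
  have haSa : a ≤ Real.sinh a := Real.self_le_sinh_iff.2 ha
  have hSaA : Real.sinh a ≤ a * Real.cosh a := sinh_le_mul_cosh ha
  have hexp : Real.cosh a - Real.sinh a ≤ 1 := by
    rw [Real.cosh_sub_sinh]; exact Real.exp_le_one_iff.2 (by linarith)
  have hltA := Real.sinh_lt_cosh (x := a)
  have hA : 1 ≤ Real.cosh a := Real.one_le_cosh a
  have hC : 1 ≤ Real.cosh p := Real.one_le_cosh p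
  have hpa := Real.cosh_sq_sub_sinh_sq a
  have hpp := Real.cosh_sq_sub_sinh_sq p
  have htb := Real.sin_sq_add_cos_sq b
  have htq := Real.sin_sq_add_cos_sq q
  generalize Real.cosh a = A at *
  generalize Real.sinh a = Sa at *
  generalize Real.cosh p = C at *
  generalize Real.sinh p = S at *
  generalize Real.cos b = cb at *
  generalize Real.sin b = sb at *
  generalize Real.cos q = cq at *
  generalize Real.sin q = sq at *
  have hvx : 0 < a * Sa * cb + b * A * sb := by positivity
  have hv₁ : (a * A * sb - b * Sa * cb) * cb ≤ (a * Sa * cb + b * A * sb) * sb := by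
    have e₁ : a * sb * cb * (A - Sa) ≤ a * sb * cb * 1 := by gcongr
    have e₂ : a * sb * cb ≤ a * sb * 1 := by gcongr
    have e₃ : a * sb ≤ Sa * b := by gcongr
    have e₄ : 0 ≤ b * sb ^ 2 * (A - Sa) := by
      have : 0 ≤ A - Sa := by linarith
      positivity
    have e₅ : Sa * b = b * Sa * (sb ^ 2 + cb ^ 2) := by rw [htb]; ring
    linarith
  have hv₂ : -((a * A * sb - b * Sa * cb) * cb) ≤ (a * Sa * cb + b * A * sb) * sb := by
    have e₁ : b * cb * (cb * Sa) ≤ sb * (cb * Sa) := by gcongr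
    have e₂ : sb * cb * Sa ≤ sb * cb * (a * A) := by gcongr
    have e₃ : 0 ≤ a * Sa * cb * sb + b * A * sb * sb := by positivity
    linarith
  generalize a * Sa * cb + b * A * sb = vx at *
  generalize a * A * sb - b * Sa * cb = vy at *
  have hcqn : cq < 0 := by
    by_contra! h
    have : 0 < C * cq + A * cb + K * vx := by positivity
    linarith
  have hcq2 : cq ^ 2 ≤ cb ^ 2 := by nlinarith
  have hsq2 : sb ^ 2 ≤ sq ^ 2 := by linarith
  have e : (C * cq) ^ 2 * sb ^ 2 - (S * sq) ^ 2 * cb ^ 2 ≤ sb ^ 2 * cb ^ 2 := by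
    have e₁ : C ^ 2 * sb ^ 2 * cq ^ 2 ≤ C ^ 2 * sb ^ 2 * cb ^ 2 := by gcongr
    have e₂ : S ^ 2 * cb ^ 2 * sb ^ 2 ≤ S ^ 2 * cb ^ 2 * sq ^ 2 := by gcongr
    have e₃ : (C ^ 2 - S ^ 2) * (sb ^ 2 * cb ^ 2) = sb ^ 2 * cb ^ 2 := by rw [hpp, one_mul]
    linarith
  have x₁ : C * cq = -(A * cb + K * vx) := by linarith
  have x₂ : S * sq = -(Sa * sb + K * vy) := by linarith
  rw [x₁, x₂] at e
  have f₁ : 0 < K * (A * (vx * sb) - Sa * (vy * cb)) * (sb * cb) := by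
    have g₁ : Sa * (vy * cb) ≤ Sa * (vx * sb) := by gcongr
    have g₂ : Sa * (vx * sb) < A * (vx * sb) := by gcongr
    have : 0 < A * (vx * sb) - Sa * (vy * cb) := by linarith
    positivity
  have f₂ : 0 ≤ K ^ 2 * ((vx * sb) ^ 2 - (vy * cb) ^ 2) := by
    have : 0 ≤ (vx * sb) ^ 2 - (vy * cb) ^ 2 := by
      have := sq_le_sq' (by linarith : -(vx * sb) ≤ vy * cb) hv₁
      linarith
    positivity
  have f₃ : (A ^ 2 - Sa ^ 2) * (sb ^ 2 * cb ^ 2) = sb ^ 2 * cb ^ 2 := by rw [hpa, one_mul]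
  linarith

theorem cosh_add_cosh_add_sinh_div_ne_of_half_pi_le {K a b p q : ℝ} (hK : 0 < K)
    (ha : 0 ≤ a) (hb : π / 2 ≤ b) (hb' : b < π) (hq : |q| + b ≤ π)
    (h₁ : Real.cosh p * Real.cos q + Real.cosh a * Real.cos b +
      K * (a * Real.sinh a * Real.cos b + b * Real.cosh a * Real.sin b) = 0)
    (h₂ : Real.sinh p * Real.sin q + Real.sinh a * Real.sin b +
      K * (a * Real.cosh a * Real.sin b - b * Real.sinh a * Real.cos b) = 0) : False := by
  have hpi := Real.pi_pos
  have hb0 : 0 < b := by linarith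
  have hcq : -Real.cos b ≤ Real.cos q := by
    rw [← Real.cos_pi_sub, ← Real.cos_abs q]
    exact Real.cos_le_cos_of_nonneg_of_le_pi (abs_nonneg q) (by linarith) (by linarith)
  have hcb : Real.cos b ≤ 0 :=
    Real.cos_nonpos_of_pi_div_two_le_of_le hb (by linarith)
  have hsb : 0 < Real.sin b := Real.sin_pos_of_pos_of_lt_pi hb0 hb'
  have hSa : 0 ≤ Real.sinh a := Real.sinh_nonneg_iff.2 ha
  have hA : 1 ≤ Real.cosh a := Real.one_le_cosh a
  have hC : 1 ≤ Real.cosh p := Real.one_le_cosh p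
  have hcc : 1 ≤ Real.cosh p * Real.cosh a - |Real.sinh p| * Real.sinh a := by
    rw [← Real.cosh_abs p, Real.abs_sinh, ← Real.cosh_sub]
    exact Real.one_le_cosh _
  have htb := Real.sin_sq_add_cos_sq b
  have htq := Real.sin_sq_add_cos_sq q
  have hpa := Real.cosh_sq_sub_sinh_sq a
  generalize Real.cosh a = A at *
  generalize Real.sinh a = Sa at *
  generalize Real.cosh p = C at *
  generalize Real.sinh p = S at *
  generalize Real.cos b = cb at *
  generalize Real.sin b = sb at *
  generalize Real.cos q = cq at *
  generalize Real.sin q = sq at *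
  have hcb' : 0 ≤ -cb := by linarith
  have hsq : |sq| ≤ sb := abs_le_of_sq_le_sq (by nlinarith) hsb.le
  have hcq0 : 0 ≤ cq := hcb'.trans hcq
  have hlt : C * cq * A * sb - S * sq * Sa * cb < sb * -cb := by
    have : 0 < K * (b * (Sa ^ 2 * cb ^ 2 + A ^ 2 * sb ^ 2)) := by positivity
    linear_combination this + A * sb * h₁ - Sa * cb * h₂ - sb * cb * hpa
  have hle : sb * -cb * 1 ≤ sb * -cb * (C * A - |S| * Sa) := by gcongr
  have hCA : C * -cb * A * sb ≤ C * cq * A * sb := by gcongr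
  have hSS : -(|S| * sb * Sa * -cb) ≤ S * sq * Sa * -cb := by
    have : |S| * |sq| * (Sa * -cb) ≤ |S| * sb * (Sa * -cb) := by gcongr
    have h' : -(|S| * |sq|) ≤ S * sq := by rw [← abs_mul]; exact neg_abs_le _
    have h'' : -(|S| * |sq|) * (Sa * -cb) ≤ S * sq * (Sa * -cb) := by gcongr
    linarith
  linarith

theorem cosh_add_cosh_add_sinh_div_ne {K a b p q : ℝ} (hK : 0 < K) (ha : 0 ≤ a) (hb : 0 ≤ b)
    (hb' : b < π) (hab : b = 0 → a ≠ 0 ∧ |q| < π) (hq : |q| + b ≤ π)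
    (h₁ : Real.cosh p * Real.cos q + Real.cosh a * Real.cos b +
      K * (a * Real.sinh a * Real.cos b + b * Real.cosh a * Real.sin b) = 0)
    (h₂ : Real.sinh p * Real.sin q + Real.sinh a * Real.sin b +
      K * (a * Real.cosh a * Real.sin b - b * Real.sinh a * Real.cos b) = 0) : False := by
  rcases hb.eq_or_lt with rfl | hb0
  · obtain ⟨ha0, hqpi⟩ := hab rfl
    have hSa : 0 ≤ Real.sinh a := Real.sinh_nonneg_iff.2 ha
    have hKa : 0 ≤ K * (a * Real.sinh a) := by positivity
    have hA : 1 < Real.cosh a := Real.one_lt_cosh.2 ha0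
    have hC : 1 ≤ Real.cosh p := Real.one_le_cosh p
    simp only [Real.cos_zero, Real.sin_zero, mul_zero, mul_one, zero_mul, add_zero, sub_zero,
      mul_eq_zero, Real.sinh_eq_zero] at h₁ h₂
    rcases h₂ with rfl | h₂
    · have := Real.neg_one_le_cos q
      rw [Real.cosh_zero] at h₁
      linarith
    · rw [abs_lt] at hqpi
      rw [(Real.sin_eq_zero_iff_of_lt_of_lt hqpi.1 hqpi.2).1 h₂, Real.cos_zero] at h₁
      linarith
  · rcases lt_or_ge b (π / 2) with h | h
    · exact cosh_add_cosh_add_sinh_div_ne_of_lt_half_pi hK ha hb0 h hq h₁ h₂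
    · exact cosh_add_cosh_add_sinh_div_ne_of_half_pi_le hK ha h hb' hq h₁ h₂

theorem cosh_re_eq (z : ℂ) : (cosh z).re = Real.cosh z.re * Real.cos z.im := by
  conv_lhs => rw [← re_add_im z, Complex.cosh_add, cosh_mul_I, sinh_mul_I]
  simp [← ofReal_cosh, ← ofReal_sinh, ← ofReal_cos, ← ofReal_sin]

theorem cosh_im_eq (z : ℂ) : (cosh z).im = Real.sinh z.re * Real.sin z.im := by
  conv_lhs => rw [← re_add_im z, Complex.cosh_add, cosh_mul_I, sinh_mul_I]
  simp [← ofReal_cosh, ← ofReal_sinh, ← ofReal_cos, ← ofReal_sin]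

theorem sinh_re_eq (z : ℂ) : (sinh z).re = Real.sinh z.re * Real.cos z.im := by
  conv_lhs => rw [← re_add_im z, Complex.sinh_add, cosh_mul_I, sinh_mul_I]
  simp [← ofReal_cosh, ← ofReal_sinh, ← ofReal_cos, ← ofReal_sin]

theorem sinh_im_eq (z : ℂ) : (sinh z).im = Real.cosh z.re * Real.sin z.im := by
  conv_lhs => rw [← re_add_im z, Complex.sinh_add, cosh_mul_I, sinh_mul_I]
  simp [← ofReal_cosh, ← ofReal_sinh, ← ofReal_cos, ← ofReal_sin]

theorem mul_cosh_add_cosh_add_sinh_ne_zero {k : ℝ} (hk : 0 < k) {d σ : ℂ} (hd : d ≠ 0)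
    (hdpi : |d.im| < π) (hσ : d.im = 0 → |σ.im| < π) (hsum : |σ.im| + |d.im| ≤ π) :
    d * (cosh σ + cosh d) + k * sinh d ≠ 0 := by
  intro h
  wlog hre : 0 ≤ d.re generalizing d
  · refine this (d := -d) (neg_ne_zero.2 hd) (by simpa using hdpi) (by simpa using hσ)
      (by simpa using hsum) ?_ (by rw [neg_re]; linarith)
    rw [Complex.cosh_neg, Complex.sinh_neg]
    linear_combination -h
  wlog him : 0 ≤ d.im generalizing d σ
  · refine this (d := starRingEnd ℂ d) (σ := starRingEnd ℂ σ) (by simpa using hd)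
      (by simpa using hdpi) (by simpa using hσ) (by simpa using hsum) ?_ (by simpa using hre)
      (by rw [conj_im]; linarith)
    simpa [← Complex.cosh_conj, ← Complex.sinh_conj] using congrArg (starRingEnd ℂ) h
  rw [abs_of_nonneg him] at hdpi hsum
  have hN : 0 < normSq d := normSq_pos.2 hd
  have e : cosh σ + cosh d + (k / normSq d : ℝ) * (starRingEnd ℂ d * sinh d) = 0 := by
    have hN' : (normSq d : ℂ) ≠ 0 := by exact_mod_cast hN.ne'
    have hdd : (normSq d : ℂ) = starRingEnd ℂ d * d := normSq_eq_conj_mul_self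
    push_cast
    field_simp
    rw [hdd]
    linear_combination (starRingEnd ℂ d) * h
  have e₁ := congrArg re e
  have e₂ := congrArg im e
  simp only [add_re, add_im, mul_re, mul_im, ofReal_re, ofReal_im, cosh_re_eq, cosh_im_eq,
    sinh_re_eq, sinh_im_eq, conj_re, conj_im, zero_re, zero_im] at e₁ e₂
  refine cosh_add_cosh_add_sinh_div_ne (div_pos hk hN) hre him hdpi
    (fun h0 => ⟨fun h1 => hd (Complex.ext h1 h0), hσ h0⟩) hsum ?_ ?_ (p := σ.re)
  · linear_combination e₁
  · linear_combination e₂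

/-- The map `u ↦ s u + c tanh u`. -/
def linearAddTanh (s c : ℝ) (u : ℂ) : ℂ := s * u + c * tanh u

/-- The two pairs of slits `{|Im w| = h, |Re w| ≥ X}`. -/
def slits (h X : ℝ) : Set ℂ := {w | |w.im| = h ∧ X ≤ |w.re|}

/-- The open strip `|Im u| < π / 2`. -/
def halfPiStrip : Set ℂ := {u | |u.im| < π / 2}

theorem linearAddTanh_eq {s c : ℝ} (hs : 0 < s) (hc : 0 < c) {u v : ℂ} (hu : |u.im| < π / 2)
    (hv : |v.im| ≤ π / 2) (hu0 : cosh u ≠ 0) (hv0 : cosh v ≠ 0)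
    (h : linearAddTanh s c u = linearAddTanh s c v) : u = v := by
  by_contra hne
  rw [abs_lt] at hu
  rw [abs_le] at hv
  have hs' : (s : ℂ) ≠ 0 := by exact_mod_cast hs.ne'
  refine mul_cosh_add_cosh_add_sinh_ne_zero (k := 2 * c / s) (by positivity) (d := u - v)
    (σ := u + v) (sub_ne_zero.2 hne) ?_ ?_ ?_ ?_
  · rw [sub_im, abs_lt]; constructor <;> linarith
  · intro h0
    rw [sub_im] at h0
    rw [add_im, abs_lt]; constructor <;> linarith
  · rw [add_im, sub_im]
    rcases abs_cases (u.im + v.im) with ⟨h1, _⟩ | ⟨h1, _⟩ <;>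
    rcases abs_cases (u.im - v.im) with ⟨h2, _⟩ | ⟨h2, _⟩ <;> rw [h1, h2] <;> linarith
  · rw [linearAddTanh, linearAddTanh, tanh_eq_sinh_div_cosh, tanh_eq_sinh_div_cosh] at h
    field_simp at h
    rw [Complex.cosh_add, Complex.cosh_sub, Complex.sinh_sub]
    push_cast
    field_simp
    linear_combination 2 * h

theorem normSq_cosh (u : ℂ) : normSq (cosh u) =
    (Real.cosh u.re * Real.cos u.im) ^ 2 + (Real.sinh u.re * Real.sin u.im) ^ 2 := by
  rw [normSq_apply, cosh_re_eq, cosh_im_eq]; ring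

theorem linearAddTanh_re (s c : ℝ) (u : ℂ) : (linearAddTanh s c u).re =
    s * u.re + c * (Real.sinh u.re * Real.cosh u.re / normSq (cosh u)) := by
  rw [linearAddTanh, add_re, re_ofReal_mul, re_ofReal_mul, tanh_eq_sinh_div_cosh, div_re,
    sinh_re_eq, sinh_im_eq, cosh_re_eq, cosh_im_eq, ← add_div]
  congr 3
  linear_combination Real.sinh u.re * Real.cosh u.re * Real.sin_sq_add_cos_sq u.im

theorem linearAddTanh_im (s c : ℝ) (u : ℂ) : (linearAddTanh s c u).im =
    s * u.im + c * (Real.sin u.im * Real.cos u.im / normSq (cosh u)) := by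
  rw [linearAddTanh, add_im, im_ofReal_mul, im_ofReal_mul, tanh_eq_sinh_div_cosh, div_im,
    sinh_re_eq, sinh_im_eq, cosh_re_eq, cosh_im_eq, ← sub_div]
  congr 3
  linear_combination Real.sin u.im * Real.cos u.im * Real.cosh_sq_sub_sinh_sq u.re

theorem mul_abs_re_le_abs_linearAddTanh_re {s c : ℝ} (hc : 0 ≤ c) (u : ℂ) :
    s * |u.re| ≤ |(linearAddTanh s c u).re| := by
  rw [linearAddTanh_re]
  have hN := normSq_nonneg (cosh u)
  have hC := Real.cosh_pos u.re
  rcases le_total 0 u.re with h | h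
  · have := Real.sinh_nonneg_iff.2 h
    rw [abs_of_nonneg h]
    refine le_trans ?_ (le_abs_self _)
    have : 0 ≤ c * (Real.sinh u.re * Real.cosh u.re / normSq (cosh u)) := by positivity
    linarith
  · have : 0 ≤ -Real.sinh u.re := by rw [neg_nonneg]; exact Real.sinh_nonpos_iff.2 h
    rw [abs_of_nonpos h]
    refine le_trans ?_ (neg_abs_le _ |> neg_le.1)
    have : 0 ≤ c * (-Real.sinh u.re * Real.cosh u.re / normSq (cosh u)) := by positivity
    rw [neg_mul, neg_div] at this
    linarith

theorem cos_eq_zero_of_abs_eq {y : ℝ} (hy : |y| = π / 2) : Real.cos y = 0 := by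
  rw [← Real.cos_abs, hy, Real.cos_pi_div_two]

theorem linearAddTanh_re_of_abs_im_eq (s c : ℝ) {u : ℂ} (hu : |u.im| = π / 2)
    (h0 : u.re ≠ 0) : (linearAddTanh s c u).re =
      s * u.re + c * (Real.cosh u.re / Real.sinh u.re) := by
  have hcos := cos_eq_zero_of_abs_eq hu
  have hsin := Real.sin_sq_add_cos_sq u.im
  have hS : Real.sinh u.re ≠ 0 := by rwa [Ne, Real.sinh_eq_zero]
  rw [linearAddTanh_re, normSq_cosh, mul_pow, mul_pow]
  rw [hcos] at hsin ⊢
  rw [show Real.sin u.im ^ 2 = 1 by linarith]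
  field_simp
  ring

theorem linearAddTanh_im_of_abs_im_eq (s c : ℝ) {u : ℂ} (hu : |u.im| = π / 2) :
    (linearAddTanh s c u).im = s * u.im := by
  rw [linearAddTanh_im, cos_eq_zero_of_abs_eq hu]; simp

theorem cosh_ne_zero_iff_of_abs_im_eq {u : ℂ} (hu : |u.im| = π / 2) :
    cosh u ≠ 0 ↔ u.re ≠ 0 := by
  have hcos := cos_eq_zero_of_abs_eq hu
  have hsin := Real.sin_sq_add_cos_sq u.im
  rw [hcos] at hsin
  rw [← normSq_pos, normSq_cosh, hcos, mul_pow, mul_pow,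
    show Real.sin u.im ^ 2 = 1 by linarith, ← Real.sinh_ne_zero]
  simp [sq_pos_iff]

theorem add_coth_ge {s c x₀ x : ℝ} (hs : 0 < s) (hx₀ : 0 < x₀) (hx : 0 < x)
    (h : s * Real.sinh x₀ ^ 2 = c) :
    s * x₀ + c * (Real.cosh x₀ / Real.sinh x₀) ≤ s * x + c * (Real.cosh x / Real.sinh x) := by
  have hS : 0 < Real.sinh x := Real.sinh_pos_iff.2 hx
  have hS₀ : 0 < Real.sinh x₀ := Real.sinh_pos_iff.2 hx₀
  have key : Real.sinh x₀ * Real.sinh (x - x₀) ≤ (x - x₀) * Real.sinh x := by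
    rcases le_total x₀ x with hle | hle
    · have hd : 0 ≤ x - x₀ := sub_nonneg.2 hle
      have e : Real.sinh x = Real.sinh x₀ * Real.cosh (x - x₀) +
          Real.cosh x₀ * Real.sinh (x - x₀) := by rw [← Real.sinh_add]; congr 1; ring
      have h1 := sinh_le_mul_cosh hd
      have h2 : 0 ≤ Real.sinh (x - x₀) := Real.sinh_nonneg_iff.2 hd
      have h3 : 0 ≤ (x - x₀) * (Real.cosh x₀ * Real.sinh (x - x₀)) := by
        have := Real.cosh_pos x₀
        positivity
      have h4 : Real.sinh x₀ * Real.sinh (x - x₀) ≤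
          Real.sinh x₀ * ((x - x₀) * Real.cosh (x - x₀)) := by gcongr
      rw [e]
      linarith
    · have hd : 0 ≤ x₀ - x := sub_nonneg.2 hle
      have h1 : x₀ - x ≤ Real.sinh (x₀ - x) := Real.self_le_sinh_iff.2 hd
      have h2 : Real.sinh x ≤ Real.sinh x₀ := Real.sinh_le_sinh.2 hle
      have h3 : (x₀ - x) * Real.sinh x ≤ Real.sinh (x₀ - x) * Real.sinh x₀ := by gcongr
      rw [← neg_sub x₀ x, Real.sinh_neg]
      linarith
  rw [Real.sinh_sub] at key
  have : s * x + c * (Real.cosh x / Real.sinh x) -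
      (s * x₀ + c * (Real.cosh x₀ / Real.sinh x₀)) = s / Real.sinh x * ((x - x₀) * Real.sinh x -
        Real.sinh x₀ * (Real.sinh x * Real.cosh x₀ - Real.cosh x * Real.sinh x₀)) := by
    rw [← h]; field_simp; ring
  have h5 : 0 ≤ s / Real.sinh x * ((x - x₀) * Real.sinh x -
        Real.sinh x₀ * (Real.sinh x * Real.cosh x₀ - Real.cosh x * Real.sinh x₀)) :=
    mul_nonneg (by positivity) (by linarith)
  linarith

theorem exists_add_coth_eq {s c x₀ y : ℝ} (hs : 0 < s) (hc : 0 < c) (hx₀ : 0 < x₀)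
    (hy : s * x₀ + c * (Real.cosh x₀ / Real.sinh x₀) ≤ y) :
    ∃ x, 0 < x ∧ s * x + c * (Real.cosh x / Real.sinh x) = y := by
  have hpos : ∀ x, 0 < x → 0 < c * (Real.cosh x / Real.sinh x) := fun x hx => by
    have := Real.sinh_pos_iff.2 hx
    have := Real.cosh_pos x
    positivity
  have hle : x₀ ≤ y / s := by
    rw [le_div_iff₀ hs]; linarith [hpos x₀ hx₀]
  have hcont : ContinuousOn (fun x => s * x + c * (Real.cosh x / Real.sinh x))
      (Set.Icc x₀ (y / s)) := by
    have : ∀ x ∈ Set.Icc x₀ (y / s), Real.sinh x ≠ 0 := fun x hx =>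
      (Real.sinh_pos_iff.2 (hx₀.trans_le hx.1)).ne'
    fun_prop (disch := assumption)
  have hend : y ≤ s * (y / s) + c * (Real.cosh (y / s) / Real.sinh (y / s)) := by
    rw [mul_div_cancel₀ y hs.ne']; linarith [hpos _ (hx₀.trans_le hle)]
  obtain ⟨x, hx, hxy⟩ := intermediate_value_Icc hle hcont ⟨hy, hend⟩
  exact ⟨x, hx₀.trans_le hx.1, hxy⟩

theorem linearAddTanh_mem_slits {s c x₀ : ℝ} (hs : 0 < s) (hx₀ : 0 < x₀)
    (h : s * Real.sinh x₀ ^ 2 = c) {u : ℂ} (hu : |u.im| = π / 2) (h0 : cosh u ≠ 0) :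
    linearAddTanh s c u ∈
      slits (s * (π / 2)) (s * x₀ + c * (Real.cosh x₀ / Real.sinh x₀)) := by
  rw [cosh_ne_zero_iff_of_abs_im_eq hu] at h0
  refine ⟨by rw [linearAddTanh_im_of_abs_im_eq s c hu, abs_mul, abs_of_pos hs, hu], ?_⟩
  rw [linearAddTanh_re_of_abs_im_eq s c hu h0]
  rcases h0.lt_or_gt with h1 | h1
  · have := add_coth_ge hs hx₀ (neg_pos.2 h1) h
    rw [Real.cosh_neg, Real.sinh_neg, div_neg] at this
    refine this.trans (le_trans (le_of_eq ?_) (neg_le_abs _))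
    ring
  · exact (add_coth_ge hs hx₀ h1 h).trans (le_abs_self _)

theorem exists_linearAddTanh_eq_of_mem_slits {s c x₀ : ℝ} (hs : 0 < s) (hc : 0 < c)
    (hx₀ : 0 < x₀) {w : ℂ}
    (hw : w ∈ slits (s * (π / 2)) (s * x₀ + c * (Real.cosh x₀ / Real.sinh x₀))) :
    ∃ u : ℂ, |u.im| = π / 2 ∧ cosh u ≠ 0 ∧ linearAddTanh s c u = w := by
  obtain ⟨him, hre⟩ := hw
  obtain ⟨x, hx, hxw⟩ := exists_add_coth_eq hs hc hx₀ hre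
  have hex : ∃ t : ℝ, t ≠ 0 ∧ s * t + c * (Real.cosh t / Real.sinh t) = w.re := by
    rcases abs_choice w.re with hr | hr
    · exact ⟨x, hx.ne', hxw.trans hr⟩
    · refine ⟨-x, neg_ne_zero.2 hx.ne', ?_⟩
      rw [Real.cosh_neg, Real.sinh_neg, div_neg]
      linarith
  obtain ⟨t, ht0, ht⟩ := hex
  have hu : |(⟨t, w.im / s⟩ : ℂ).im| = π / 2 := by
    rw [abs_div, him, abs_of_pos hs]; field_simp
  refine ⟨⟨t, w.im / s⟩, hu, (cosh_ne_zero_iff_of_abs_im_eq hu).2 ht0, Complex.ext ?_ ?_⟩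
  · rw [linearAddTanh_re_of_abs_im_eq s c hu ht0, ht]
  · rw [linearAddTanh_im_of_abs_im_eq s c hu]; field_simp

theorem isOpen_halfPiStrip : IsOpen halfPiStrip :=
  isOpen_lt (continuous_abs.comp Complex.continuous_im) continuous_const

theorem convex_halfPiStrip : Convex ℝ halfPiStrip := by
  have : halfPiStrip = {u : ℂ | -(π / 2) < u.im} ∩ {u : ℂ | u.im < π / 2} := by
    ext u; exact abs_lt (a := u.im)
  rw [this]
  exact (convex_halfSpace_im_gt _).inter (convex_halfSpace_im_lt _)

theorem cosh_ne_zero_of_mem_halfPiStrip {u : ℂ} (hu : u ∈ halfPiStrip) : cosh u ≠ 0 := by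
  intro h
  have h1 := congrArg re h
  rw [cosh_re_eq, zero_re] at h1
  have hlt := abs_lt.1 (show |u.im| < π / 2 from hu)
  exact (mul_pos (Real.cosh_pos _) (Real.cos_pos_of_mem_Ioo hlt)).ne' h1

theorem injOn_linearAddTanh {s c : ℝ} (hs : 0 < s) (hc : 0 < c) :
    Set.InjOn (linearAddTanh s c) halfPiStrip := fun _ hu _ hv h =>
  linearAddTanh_eq hs hc hu (le_of_lt hv) (cosh_ne_zero_of_mem_halfPiStrip hu)
    (cosh_ne_zero_of_mem_halfPiStrip hv) h

theorem isOpen_image_linearAddTanh {s c : ℝ} (hs : 0 < s) (hc : 0 < c) :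
    IsOpen (linearAddTanh s c '' halfPiStrip) := by
  have hd : DifferentiableOn ℂ (linearAddTanh s c) halfPiStrip := by
    intro u hu
    have h0 := cosh_ne_zero_of_mem_halfPiStrip hu
    have : DifferentiableAt ℂ (fun u : ℂ => (s : ℂ) * u + c * (sinh u / cosh u)) u := by
      fun_prop (disch := assumption)
    refine (this.congr_of_eventuallyEq (Filter.Eventually.of_forall fun v => ?_))
      |>.differentiableWithinAt
    rw [linearAddTanh, tanh_eq_sinh_div_cosh]
  rcases (hd.analyticOnNhd isOpen_halfPiStrip).is_constant_or_isOpen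
    convex_halfPiStrip.isPreconnected with ⟨w, hw⟩ | h
  · have h0 : (0 : ℂ) ∈ halfPiStrip := by simp [halfPiStrip, Real.pi_pos]
    have h1 : (1 : ℂ) ∈ halfPiStrip := by simp [halfPiStrip, Real.pi_pos]
    exact absurd (injOn_linearAddTanh hs hc h0 h1 ((hw 0 h0).trans (hw 1 h1).symm)) zero_ne_one
  · exact h _ subset_rfl isOpen_halfPiStrip

theorem closure_image_linearAddTanh_inter_subset {s c x₀ : ℝ} (hs : 0 < s) (hc : 0 < c)
    (hx₀ : 0 < x₀) (h : s * Real.sinh x₀ ^ 2 = c) :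
    closure (linearAddTanh s c '' halfPiStrip) ∩
      (slits (s * (π / 2)) (s * x₀ + c * (Real.cosh x₀ / Real.sinh x₀)))ᶜ ⊆
      linearAddTanh s c '' halfPiStrip := by
  rintro w ⟨hw, hws⟩
  obtain ⟨W, hW, hWlim⟩ := mem_closure_iff_seq_limit.1 hw
  choose u hu huW using hW
  obtain ⟨B, hB⟩ := hWlim.norm.bddAbove_range
  have hbd : ∀ n, u n ∈ Metric.closedBall (0 : ℂ) (B / s + π / 2) := fun n => by
    rw [mem_closedBall_zero_iff]
    refine (norm_le_abs_re_add_abs_im _).trans (add_le_add ?_ (le_of_lt (hu n)))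
    rw [le_div_iff₀ hs, mul_comm]
    refine (mul_abs_re_le_abs_linearAddTanh_re hc.le _).trans ?_
    rw [huW]
    exact (abs_re_le_norm _).trans (hB ⟨n, rfl⟩)
  obtain ⟨a, -, ψ, hψ, hlim⟩ := tendsto_subseq_of_bounded Metric.isBounded_closedBall hbd
  have ha : |a.im| ≤ π / 2 :=
    le_of_tendsto' ((continuous_abs.comp Complex.continuous_im).tendsto a |>.comp hlim)
      fun n => le_of_lt (hu (ψ n))
  have hprod : w * cosh a = s * a * cosh a + c * sinh a := by
    have l₁ := (hWlim.comp hψ.tendsto_atTop).mul ((Complex.continuous_cosh.tendsto a).comp hlim)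
    have hct : Continuous fun v : ℂ => s * v * cosh v + c * sinh v := by fun_prop
    have l₂ := (hct.tendsto a).comp hlim
    refine tendsto_nhds_unique l₁ (l₂.congr fun n => ?_)
    have h0 := cosh_ne_zero_of_mem_halfPiStrip (hu (ψ n))
    simp only [Function.comp_apply]
    rw [← huW, linearAddTanh, tanh_eq_sinh_div_cosh]
    field_simp
  have ha0 : cosh a ≠ 0 := by
    intro h0
    have hsq := Complex.cosh_sq_sub_sinh_sq a
    rw [h0] at hprod hsq
    have hc' : (c : ℂ) ≠ 0 := by exact_mod_cast hc.ne'
    have : sinh a = 0 := by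
      have : (c : ℂ) * sinh a = 0 := by linear_combination -hprod
      exact (mul_eq_zero.1 this).resolve_left hc'
    rw [this] at hsq
    norm_num at hsq
  have hFa : linearAddTanh s c a = w := by
    rw [linearAddTanh, tanh_eq_sinh_div_cosh]
    field_simp
    linear_combination -hprod
  rcases ha.lt_or_eq with hlt | heq
  · exact ⟨a, hlt, hFa⟩
  · exact absurd (hFa ▸ linearAddTanh_mem_slits hs hx₀ h heq ha0) hws

theorem compl_slits_eq (h X : ℝ) : (slits h X)ᶜ =
    {w : ℂ | |w.re| < X} ∪ {w : ℂ | h < w.im} ∪ {w : ℂ | w.im < -h} ∪ {w : ℂ | |w.im| < h} := by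
  ext w
  simp only [slits, mem_compl_iff, mem_ofPred_eq, mem_union, not_and_or, not_le]
  grind

theorem isPreconnected_compl_slits {h X : ℝ} (hh : 0 < h) (hX : 0 < X) :
    IsPreconnected (slits h X)ᶜ := by
  have c₁ : IsPreconnected {w : ℂ | |w.re| < X} := by
    simp only [abs_lt]
    exact ((convex_halfSpace_re_gt _).inter (convex_halfSpace_re_lt _)).isPreconnected
  have c₂ : IsPreconnected {w : ℂ | h < w.im} := (convex_halfSpace_im_gt _).isPreconnected
  have c₃ : IsPreconnected {w : ℂ | w.im < -h} := (convex_halfSpace_im_lt _).isPreconnected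
  have c₄ : IsPreconnected {w : ℂ | |w.im| < h} := by
    simp only [abs_lt]
    exact ((convex_halfSpace_im_gt _).inter (convex_halfSpace_im_lt _)).isPreconnected
  rw [compl_slits_eq]
  refine ((c₁.union (⟨0, h + 1⟩ : ℂ) ?_ ?_ c₂).union (⟨0, -h - 1⟩ : ℂ) ?_ ?_ c₃).union
    (0 : ℂ) ?_ ?_ c₄ <;> simp [hX, hh]

theorem image_linearAddTanh {s c x₀ : ℝ} (hs : 0 < s) (hc : 0 < c)
    (hx₀ : 0 < x₀) (h : s * Real.sinh x₀ ^ 2 = c) :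
    linearAddTanh s c '' halfPiStrip =
      (slits (s * (π / 2)) (s * x₀ + c * (Real.cosh x₀ / Real.sinh x₀)))ᶜ := by
  have hX : 0 < s * x₀ + c * (Real.cosh x₀ / Real.sinh x₀) := by
    have := Real.sinh_pos_iff.2 hx₀
    have := Real.cosh_pos x₀
    positivity
  have hh : 0 < s * (π / 2) := by positivity
  refine Subset.antisymm ?_ ?_
  · rintro _ ⟨u, hu, rfl⟩ hmem
    obtain ⟨v, hv, hv0, hvu⟩ := exists_linearAddTanh_eq_of_mem_slits hs hc hx₀ hmem
    have := linearAddTanh_eq hs hc hu hv.le (cosh_ne_zero_of_mem_halfPiStrip hu) hv0 hvu.symm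
    subst this
    exact (ne_of_lt hu) hv
  · refine (isPreconnected_compl_slits hh hX).subset_of_closure_inter_subset
      (isOpen_image_linearAddTanh hs hc) ⟨0, ?_, 0, ?_, ?_⟩
      (closure_image_linearAddTanh_inter_subset hs hc hx₀ h)
    · simp [slits, hh.ne]
    · simp [halfPiStrip, Real.pi_pos]
    · simp [linearAddTanh]

theorem add_div_sub_re_pos {z : ℂ} (hz : z ∈ unitDisk) : 0 < ((1 + z) / (1 - z)).re := by
  rw [unitDisk, mem_ball_zero_iff] at hz
  have hz2 : z.re ^ 2 + z.im ^ 2 < 1 := by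
    have := normSq_eq_norm_sq z
    rw [normSq_apply] at this
    nlinarith [norm_nonneg z]
  have h1 : 1 - z ≠ 0 := by
    intro h
    rw [← sub_eq_zero.1 h] at hz
    simp at hz
  have hN := normSq_pos.2 h1
  rw [div_re, ← add_div]
  refine div_pos ?_ hN
  simp only [add_re, add_im, sub_re, sub_im, one_re, one_im]
  nlinarith

theorem sub_div_add_mem_unitDisk {w : ℂ} (hw : 0 < w.re) : (w - 1) / (w + 1) ∈ unitDisk := by
  have h1 : w + 1 ≠ 0 := by
    intro h
    have := congrArg re h
    simp only [add_re, one_re, zero_re] at this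
    linarith
  rw [unitDisk, mem_ball_zero_iff, norm_div, div_lt_one (norm_pos_iff.2 h1)]
  refine lt_of_pow_lt_pow_left₀ 2 (norm_nonneg _) ?_
  rw [← normSq_eq_norm_sq, ← normSq_eq_norm_sq, normSq_apply, normSq_apply]
  simp only [add_re, add_im, sub_re, sub_im, one_re, one_im]
  nlinarith

theorem log_add_div_sub_mem_halfPiStrip {z : ℂ} (hz : z ∈ unitDisk) :
    Complex.log ((1 + z) / (1 - z)) ∈ halfPiStrip := by
  rw [halfPiStrip, mem_ofPred_eq, log_im, abs_arg_lt_pi_div_two_iff]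
  exact Or.inl (add_div_sub_re_pos hz)

theorem one_sub_ne_zero_of_mem_unitDisk {z : ℂ} (hz : z ∈ unitDisk) : 1 - z ≠ 0 := by
  intro h
  have := add_div_sub_re_pos hz
  simp [h] at this

theorem bijOn_log_add_div_sub :
    Set.BijOn (fun z => Complex.log ((1 + z) / (1 - z))) unitDisk halfPiStrip := by
  have hexp : ∀ {z}, z ∈ unitDisk →
      exp (Complex.log ((1 + z) / (1 - z))) = (1 + z) / (1 - z) := fun hz =>
    exp_log fun h => by
      have := add_div_sub_re_pos hz
      simp [h] at this
  refine ⟨fun z hz => log_add_div_sub_mem_halfPiStrip hz, fun z hz w hw h => ?_, fun u hu => ?_⟩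
  · have e := congrArg exp h
    simp only [hexp hz, hexp hw] at e
    have hz1 := one_sub_ne_zero_of_mem_unitDisk hz
    have hw1 := one_sub_ne_zero_of_mem_unitDisk hw
    field_simp at e
    linear_combination e / 2
  · have hlt := abs_lt.1 (show |u.im| < π / 2 from hu)
    have hre : 0 < (exp u).re := by
      rw [exp_re]
      exact mul_pos (Real.exp_pos _) (Real.cos_pos_of_mem_Ioo hlt)
    refine ⟨(exp u - 1) / (exp u + 1), sub_div_add_mem_unitDisk hre, ?_⟩
    have h1 : exp u + 1 ≠ 0 := by
      intro h
      have := congrArg re h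
      simp only [add_re, one_re, zero_re] at this
      linarith
    have e : (1 + (exp u - 1) / (exp u + 1)) / (1 - (exp u - 1) / (exp u + 1)) = exp u := by
      have : 1 - (exp u - 1) / (exp u + 1) ≠ 0 := by
        rw [one_sub_div h1]
        exact div_ne_zero (by ring_nf; norm_num) h1
      rw [div_eq_iff this]
      field_simp
      ring
    simp only [e]
    exact Complex.log_exp (by linarith [Real.pi_pos]) (by linarith [Real.pi_pos])

theorem tanh_log_add_div_sub {z : ℂ} (hz : z ∈ unitDisk) :
    tanh (Complex.log ((1 + z) / (1 - z))) = 2 * z / (1 + z ^ 2) := by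
  have hre := add_div_sub_re_pos hz
  have hm := one_sub_ne_zero_of_mem_unitDisk hz
  have h0 : (1 + z) / (1 - z) ≠ 0 := fun h => by simp [h] at hre
  have hp : 1 + z ≠ 0 := fun h => h0 (by simp [h])
  have hu := cosh_ne_zero_of_mem_halfPiStrip (log_add_div_sub_mem_halfPiStrip hz)
  have hcosh : cosh (Complex.log ((1 + z) / (1 - z))) = (1 + z ^ 2) / ((1 + z) * (1 - z)) := by
    rw [Complex.cosh, Complex.exp_neg, Complex.exp_log h0]
    field_simp
    ring
  have hsinh : sinh (Complex.log ((1 + z) / (1 - z))) = 2 * z / ((1 + z) * (1 - z)) := by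
    rw [Complex.sinh, Complex.exp_neg, Complex.exp_log h0]
    field_simp
    ring
  rw [tanh_eq_sinh_div_cosh, hcosh, hsinh]
  exact div_div_div_cancel_right₀ (mul_ne_zero hp hm) _ _

theorem isCHD_compl_slits (h X : ℝ) : IsCHD (slits h X)ᶜ := by
  intro t
  have hline : Convex ℝ {z : ℂ | z.im = t} := by
    have : {z : ℂ | z.im = t} = {z : ℂ | z.im ≤ t} ∩ {z : ℂ | t ≤ z.im} := by
      ext z; exact le_antisymm_iff
    rw [this]
    exact (convex_halfSpace_im_le t).inter (convex_halfSpace_im_ge t)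
  by_cases ht : |t| = h
  · have : {z : ℂ | z ∈ (slits h X)ᶜ ∧ z.im = t} =
        ({z : ℂ | -X < z.re} ∩ {z : ℂ | z.re < X}) ∩ {z : ℂ | z.im = t} := by
      ext z
      simp only [slits, mem_compl_iff, mem_ofPred_eq, mem_inter_iff, not_and, not_le, ← abs_lt]
      grind
    rw [this]
    exact (((convex_halfSpace_re_gt _).inter (convex_halfSpace_re_lt _)).inter
      hline).isPreconnected
  · have : {z : ℂ | z ∈ (slits h X)ᶜ ∧ z.im = t} = {z : ℂ | z.im = t} := by
      ext z
      simp only [slits, mem_compl_iff, mem_ofPred_eq, not_and, not_le]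
      grind
    rw [this]
    exact hline.isPreconnected

theorem nehari_slit_mapping_image
    (α : ℝ) (hα : α ∈ Set.Ioo 0 (Real.pi / 2)) :
    let φ : ℂ → ℂ := fun z =>
      (1 / 2 : ℂ) * (Real.sin α : ℂ) ^ 2 * Complex.log ((1 + z) / (1 - z)) +
        z * (Real.cos α : ℂ) ^ 2 / (1 + z ^ 2)
    let x₀ : ℝ := 1 / 2 * Real.sin α ^ 2 * Real.log (Real.cot (α / 2)) + Real.cos α / 2
    let Lminus : Set ℂ := {w : ℂ |
      (w.im = Real.pi * Real.sin α ^ 2 / 4 ∨ w.im = -(Real.pi * Real.sin α ^ 2 / 4)) ∧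
        w.re ≤ -x₀}
    let Lplus : Set ℂ := {w : ℂ |
      (w.im = Real.pi * Real.sin α ^ 2 / 4 ∨ w.im = -(Real.pi * Real.sin α ^ 2 / 4)) ∧
        x₀ ≤ w.re}
    Set.InjOn φ unitDisk ∧ φ '' unitDisk = (Lminus ∪ Lplus)ᶜ ∧ IsCHD (φ '' unitDisk) := by
  obtain ⟨h₀, h₁⟩ := hα
  intro φ x₀ Lminus Lplus
  have hsin : 0 < Real.sin α := Real.sin_pos_of_pos_of_lt_pi h₀ (by linarith)
  have hcos : 0 < Real.cos α := Real.cos_pos_of_mem_Ioo ⟨by linarith, h₁⟩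
  have hcot : Real.cot (α / 2) = (1 + Real.cos α) / Real.sin α := by
    have hs : 0 < Real.sin (α / 2) := Real.sin_pos_of_pos_of_lt_pi (by linarith) (by linarith)
    have hc : 0 < Real.cos (α / 2) := Real.cos_pos_of_mem_Ioo ⟨by linarith, by linarith⟩
    have e : α = 2 * (α / 2) := by ring
    rw [Real.cot_eq_cos_div_sin, show Real.cos α = 2 * Real.cos (α / 2) ^ 2 - 1 by
      conv_lhs => rw [e, Real.cos_two_mul], show Real.sin α = 2 * Real.sin (α / 2) *
      Real.cos (α / 2) by conv_lhs => rw [e, Real.sin_two_mul]]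
    field_simp
    ring
  have htrig := Real.sin_sq_add_cos_sq α
  have hcot_pos : 0 < Real.cot (α / 2) := by rw [hcot]; positivity
  have hsinh : Real.sinh (Real.log (Real.cot (α / 2))) = Real.cos α / Real.sin α := by
    rw [Real.sinh_log hcot_pos, hcot]
    field_simp
    linear_combination -htrig
  have hcosh : Real.cosh (Real.log (Real.cot (α / 2))) = 1 / Real.sin α := by
    rw [Real.cosh_log hcot_pos, hcot]
    field_simp
    linear_combination htrig
  have hlog : 0 < Real.log (Real.cot (α / 2)) := by
    rw [← Real.sinh_pos_iff, hsinh]; positivity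
  have hs : 0 < Real.sin α ^ 2 := by positivity
  have hc : 0 < Real.cos α ^ 2 := by positivity
  have hX : Real.sin α ^ 2 * Real.log (Real.cot (α / 2)) + Real.cos α ^ 2 *
      (Real.cosh (Real.log (Real.cot (α / 2))) / Real.sinh (Real.log (Real.cot (α / 2)))) =
      2 * x₀ := by
    rw [hsinh, hcosh]
    simp only [x₀]
    field_simp
  have himg := image_linearAddTanh hs hc hlog (by rw [hsinh]; field_simp)
  rw [hX] at himg
  have hφ : ∀ z ∈ unitDisk, φ z = linearAddTanh (Real.sin α ^ 2) (Real.cos α ^ 2)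
      (Complex.log ((1 + z) / (1 - z))) / 2 := fun z hz => by
    simp only [φ, linearAddTanh, tanh_log_add_div_sub hz]
    push_cast
    ring
  have hslits : (Lminus ∪ Lplus)ᶜ = (slits (Real.sin α ^ 2 * (π / 4)) x₀)ᶜ := by
    congr 1
    ext w
    have hh : 0 ≤ Real.sin α ^ 2 * (π / 4) := by positivity
    simp only [Lminus, Lplus, slits, mem_union, mem_ofPred_eq, ← and_or_left, le_abs, le_neg,
      abs_eq hh, show π * Real.sin α ^ 2 / 4 = Real.sin α ^ 2 * (π / 4) by ring]
    tauto
  have hmain : φ '' unitDisk = (Lminus ∪ Lplus)ᶜ := by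
    rw [hslits]
    have hdouble : ∀ w : ℂ, 2 * w ∈ slits (Real.sin α ^ 2 * (π / 2)) (2 * x₀) ↔
        w ∈ slits (Real.sin α ^ 2 * (π / 4)) x₀ := fun w => by
      simp only [slits, mem_ofPred_eq]
      rw [show (2 * w).im = 2 * w.im by simp, show (2 * w).re = 2 * w.re by simp, abs_mul,
        abs_mul, abs_two]
      constructor <;> rintro ⟨ha, hb⟩ <;> constructor <;> linarith
    ext w
    rw [mem_compl_iff, ← hdouble, ← mem_compl_iff, ← himg]
    constructor
    · rintro ⟨z, hz, rfl⟩
      refine ⟨_, bijOn_log_add_div_sub.mapsTo hz, ?_⟩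
      rw [hφ z hz]
      ring
    · rintro ⟨u, hu, huw⟩
      obtain ⟨z, hz, rfl⟩ := bijOn_log_add_div_sub.surjOn hu
      refine ⟨z, hz, ?_⟩
      rw [hφ z hz, huw]
      ring
  refine ⟨fun z hz w hw h => ?_, hmain, ?_⟩
  · rw [hφ z hz, hφ w hw] at h
    exact bijOn_log_add_div_sub.injOn hz hw (injOn_linearAddTanh hs hc
      (bijOn_log_add_div_sub.mapsTo hz) (bijOn_log_add_div_sub.mapsTo hw)
      ((div_left_inj' two_ne_zero).1 h))
  · rw [hmain, hslits]
    exact isCHD_compl_slits _ _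
end
end

section
/- Let α ∈ (0, π/2), let φ_α(z) = (1/2)sin²α · Log((1+z)/(1−z)) + z·cos²α/(1+z²) on 𝔻, and let n be a positive integer. Then the harmonic shear f_α(z) = 2 Re[ ∫₀^z φ_α'(ζ)/(1−ζⁿ) dζ ] − conj(φ_α(z)) of φ_α with dilatation ω(z) = zⁿ is injective on 𝔻 and f_α(𝔻) is convex in the horizontal direction. -/
open Complex Set
open scoped Real

noncomputable section

open Filter Topology

/-- **Noshiro–Warschawski theorem**: a holomorphic function whose derivative has positive real part
on a convex open set is injective there. -/
lemma injOn_of_re_deriv_pos {S : Set ℂ} (hS : Convex ℝ S) {Φ Φ' : ℂ → ℂ}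
    (hΦ : ∀ w ∈ S, HasDerivAt Φ (Φ' w) w) (hpos : ∀ w ∈ S, 0 < (Φ' w).re) : InjOn Φ S := by
  intro a ha b hb hab
  by_contra hne
  have hseg : ∀ s ∈ Icc (0 : ℝ) 1, a + s * (b - a) ∈ S := fun s hs => by
    simpa using hS.add_smul_sub_mem ha hb hs
  have hder : ∀ s ∈ Icc (0 : ℝ) 1,
      HasDerivAt (fun s : ℝ => (Φ (a + s * (b - a)) * (starRingEnd ℂ) (b - a)).re)
        (normSq (b - a) * (Φ' (a + s * (b - a))).re) s := fun s hs => by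
    have hlin : HasDerivAt (fun s : ℂ => a + s * (b - a)) (b - a) (s : ℂ) := by
      simpa using ((hasDerivAt_id (s : ℂ)).mul_const (b - a)).const_add a
    have h := (((hΦ _ (hseg s hs)).comp (s : ℂ) hlin).mul_const
      ((starRingEnd ℂ) (b - a))).real_of_complex
    refine h.congr_deriv ?_
    rw [mul_assoc, mul_conj, mul_comm, re_ofReal_mul]
  have hmono := strictMonoOn_of_deriv_pos (convex_Icc (0 : ℝ) 1)
    (fun s hs => (hder s hs).continuousAt.continuousWithinAt) fun s hs => by
      have hs' := interior_subset hs
      rw [(hder s hs').deriv]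
      exact mul_pos (normSq_pos.2 (sub_ne_zero.2 (Ne.symm hne))) (hpos _ (hseg s hs'))
  have h01 := hmono (left_mem_Icc.2 zero_le_one) (right_mem_Icc.2 zero_le_one) zero_lt_one
  simp [hab] at h01

/-- Clunie–Sheil-Small shearing: a map with the imaginary part of `φ` and the real part of `k`,
where `k' / φ'` has positive real part, inherits injectivity and convexity in the horizontal
direction from `φ`. -/
lemma injOn_and_isCHD_of_shear {U : Set ℂ} (hU : IsOpen U) {φ k F : ℂ → ℂ}
    (hφ : DifferentiableOn ℂ φ U) (hinj : InjOn φ U) (hφ0 : ∀ z ∈ U, deriv φ z ≠ 0)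
    (hCHD : IsCHD (φ '' U))
    (hk : ∀ z ∈ U, ∃ p : ℂ, 0 < p.re ∧ HasDerivAt k (p * deriv φ z) z)
    (hre : ∀ z ∈ U, (F z).re = (k z).re) (him : ∀ z ∈ U, (F z).im = (φ z).im) :
    InjOn F U ∧ IsCHD (F '' U) := by
  set ψ := Function.invFunOn φ U
  have hψφ : ∀ z ∈ U, ψ (φ z) = z := fun z hz => hinj.leftInvOn_invFunOn hz
  have hψ : ∀ z ∈ U, HasDerivAt ψ (deriv φ z)⁻¹ (φ z) := fun z hz => by
    have hs : HasStrictDerivAt φ (deriv φ z) z :=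
      (hφ.analyticAt (hU.mem_nhds hz)).hasStrictDerivAt
    exact (hs.to_local_left_inverse (hφ0 z hz)
      (eventually_of_mem (hU.mem_nhds hz) hψφ)).hasDerivAt
  refine ⟨fun a ha b hb hab => ?_, fun t => ?_⟩
  · have himab : (φ a).im = (φ b).im := by rw [← him a ha, ← him b hb, hab]
    have hreab : (k a).re = (k b).re := by rw [← hre a ha, ← hre b hb, hab]
    set t := (φ a).im with ht
    have hJ := ((hCHD t).image re continuous_re.continuousOn).ordConnected
    have hline : ∀ r ∈ re '' {z | z ∈ φ '' U ∧ z.im = t}, ∃ z ∈ U, φ z = r + t * I := by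
      rintro _ ⟨_, ⟨⟨z, hz, rfl⟩, hzt⟩, rfl⟩
      exact ⟨z, hz, by rw [← hzt, re_add_im]⟩
    have hder : ∀ r ∈ re '' {z | z ∈ φ '' U ∧ z.im = t}, ∃ d, 0 < d ∧
        HasDerivAt (fun r : ℝ => (k (ψ (r + t * I))).re) d r := fun r hr => by
      obtain ⟨z, hz, hzr⟩ := hline r hr
      obtain ⟨p, hp, hkp⟩ := hk z hz
      refine ⟨p.re, hp, ?_⟩
      have h1 : HasDerivAt (fun s : ℂ => s + t * I) 1 (r : ℂ) := (hasDerivAt_id _).add_const _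
      have h2 := hψ z hz
      have h3 : HasDerivAt k (p * deriv φ z) (ψ (φ z)) := by rwa [hψφ z hz]
      rw [hzr] at h2 h3
      refine ((h3.comp (r : ℂ) (h2.comp (r : ℂ) h1)).real_of_complex).congr_deriv ?_
      rw [mul_one, mul_assoc, mul_inv_cancel₀ (hφ0 z hz), mul_one]
    choose! d hd hder using hder
    have hmono := strictMonoOn_of_deriv_pos hJ.convex
      (fun r hr => (hder r hr).continuousAt.continuousWithinAt) fun r hr => by
        rw [(hder r (interior_subset hr)).deriv]
        exact hd r (interior_subset hr)
    have ha' : ((φ a).re : ℂ) + t * I = φ a := re_add_im _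
    have hb' : ((φ b).re : ℂ) + t * I = φ b := by rw [himab, re_add_im]
    have hr : (φ a).re = (φ b).re := hmono.injOn
      ⟨φ a, ⟨mem_image_of_mem φ ha, rfl⟩, rfl⟩
      ⟨φ b, ⟨mem_image_of_mem φ hb, himab.symm⟩, rfl⟩
      (by simp only [ha', hb', hψφ a ha, hψφ b hb, hreab])
    exact hinj ha hb (Complex.ext hr himab)
  · have hcont : ContinuousOn (fun w => ((k (ψ w)).re : ℂ) + (w.im : ℂ) * I) (φ '' U) := by
      rintro _ ⟨z, hz, rfl⟩
      obtain ⟨p, -, hp⟩ := hk z hz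
      have hkψ : ContinuousAt (k ∘ ψ) (φ z) :=
        ContinuousAt.comp (by rw [hψφ z hz]; exact hp.continuousAt) (hψ z hz).continuousAt
      have hre' : ContinuousAt (fun w => ((k (ψ w)).re : ℂ)) (φ z) :=
        (continuous_ofReal.comp continuous_re).continuousAt.comp hkψ
      exact (hre'.add (by fun_prop)).continuousWithinAt
    convert (hCHD t).image _ (hcont.mono fun w hw => hw.1) using 1
    ext w
    have hF : ∀ z ∈ U, ((k (ψ (φ z))).re : ℂ) + ((φ z).im : ℂ) * I = F z := fun z hz => by
      rw [hψφ z hz, ← hre z hz, ← him z hz, re_add_im]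
    constructor
    · rintro ⟨⟨z, hz, rfl⟩, hzt⟩
      exact ⟨φ z, ⟨mem_image_of_mem φ hz, by rw [← him z hz, hzt]⟩, hF z hz⟩
    · rintro ⟨_, ⟨⟨z, hz, rfl⟩, hzt⟩, rfl⟩
      simp only [hF z hz]
      exact ⟨mem_image_of_mem F hz, by rw [him z hz, hzt]⟩

/-- The image of a vertical strip under a holomorphic map whose derivative has positive real part,
and whose imaginary part takes all real values on each vertical line, is convex in the horizontal
direction. -/
lemma isCHD_image_strip {a b : ℝ} {Φ Φ' : ℂ → ℂ}
    (hΦ : ∀ w : ℂ, w.re ∈ Ioo a b → HasDerivAt Φ (Φ' w) w)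
    (hpos : ∀ w : ℂ, w.re ∈ Ioo a b → 0 < (Φ' w).re)
    (htop : ∀ x ∈ Ioo a b, Tendsto (fun y : ℝ => (Φ (x + y * I)).im) atTop atTop)
    (hbot : ∀ x ∈ Ioo a b, Tendsto (fun y : ℝ => (Φ (x + y * I)).im) atBot atBot) :
    IsCHD (Φ '' {w | w.re ∈ Ioo a b}) := by
  intro t
  have hder : ∀ x ∈ Ioo a b, ∀ y : ℝ,
      HasDerivAt (fun y : ℝ => (Φ (x + y * I)).im) (Φ' (x + y * I)).re y := fun x hx y => by
    have hlin : HasDerivAt (fun s : ℂ => (x : ℂ) + s * I) I (y : ℂ) := by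
      simpa using ((hasDerivAt_id (y : ℂ)).mul_const I).const_add (x : ℂ)
    have h := (((hΦ (x + y * I) (by simpa using hx)).comp (y : ℂ) hlin).mul_const
      (-I)).real_of_complex
    simpa [mul_assoc] using! h
  have hmono : ∀ x ∈ Ioo a b, StrictMono fun y : ℝ => (Φ (x + y * I)).im := fun x hx =>
    strictMono_of_deriv_pos fun y => by
      rw [(hder x hx y).deriv]
      exact hpos _ (by simpa using hx)
  have hsurj : ∀ x ∈ Ioo a b, ∃ y : ℝ, (Φ (x + y * I)).im = t := fun x hx =>
    (continuous_iff_continuousAt.2 fun y => (hder x hx y).continuousAt).surjective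
      (htop x hx) (hbot x hx) t
  choose! Y hY using hsurj
  have hval : ∀ y : ℝ, ∀ x ∈ Ioo a b, ContinuousAt (fun x : ℝ => (Φ (x + y * I)).im) x :=
    fun y x hx => continuous_im.continuousAt.comp
      (ContinuousAt.comp (f := fun x : ℝ => (x : ℂ) + y * I)
        (hΦ (x + y * I) (by simpa using hx)).continuousAt (by fun_prop))
  have hYcont : ContinuousOn Y (Ioo a b) := fun x hx => by
    refine tendsto_nhdsWithin_of_tendsto_nhds
      (tendsto_order.2 ⟨fun y hy => ?_, fun y hy => ?_⟩)
    · have hlt : (Φ (x + y * I)).im < t := hY x hx ▸ hmono x hx hy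
      filter_upwards [(hval y x hx).eventually_lt_const hlt, Ioo_mem_nhds hx.1 hx.2] with u hu hu'
      exact (hmono u hu').lt_iff_lt.1 (hu.trans_eq (hY u hu').symm)
    · have hlt : t < (Φ (x + y * I)).im := hY x hx ▸ hmono x hx hy
      filter_upwards [(hval y x hx).eventually_const_lt hlt, Ioo_mem_nhds hx.1 hx.2] with u hu hu'
      exact (hmono u hu').lt_iff_lt.1 ((hY u hu').trans_lt hu)
  have hcurve : ContinuousOn (fun x : ℝ => Φ (x + Y x * I)) (Ioo a b) :=
    ContinuousOn.comp (t := {w | w.re ∈ Ioo a b}) (f := fun x : ℝ => (x : ℂ) + Y x * I)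
      (fun w hw => (hΦ w hw).continuousAt.continuousWithinAt)
      (by fun_prop) fun x hx => by simpa using hx
  convert isPreconnected_Ioo.image _ hcurve using 1
  ext w
  constructor
  · rintro ⟨⟨v, hv, rfl⟩, hvt⟩
    refine ⟨v.re, hv, ?_⟩
    have hvY : Y v.re = v.im := (hmono v.re hv).injective (by simp [hY v.re hv, hvt])
    simp [hvY]
  · rintro ⟨x, hx, rfl⟩
    exact ⟨mem_image_of_mem Φ (by simpa using hx), hY x hx⟩

/-- The integral along segments of a holomorphic function on the unit disk is a primitive. -/
lemma hasDerivAt_segInt {g : ℂ → ℂ} (hg : DifferentiableOn ℂ g unitDisk) {z : ℂ}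
    (hz : z ∈ unitDisk) : HasDerivAt (segInt g) (g z) z := by
  obtain ⟨G, hG⟩ := DifferentiableOn.isExactOn_ball hg
  have heq : ∀ w ∈ unitDisk, segInt g w = G w - G 0 := fun w hw => by
    have hmem : ∀ t ∈ uIcc (0 : ℝ) 1, (t : ℂ) * w ∈ unitDisk := fun t ht => by
      rw [uIcc_of_le zero_le_one] at ht
      have h := (convex_ball (0 : ℂ) 1).smul_mem_of_zero_mem (by simp) hw ht
      rwa [real_smul] at h
    have hd : ∀ t ∈ uIcc (0 : ℝ) 1,
        HasDerivAt (fun t : ℝ => G (t * w)) (w * g (t * w)) t := fun t ht => by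
      have hlin : HasDerivAt (fun s : ℂ => s * w) w (t : ℂ) := by
        simpa using (hasDerivAt_id (t : ℂ)).mul_const w
      have h := ((hG _ (hmem t ht)).comp (t : ℂ) hlin).comp_ofReal
      rwa [mul_comm] at h
    have hint : IntervalIntegrable (fun t : ℝ => w * g (t * w)) MeasureTheory.volume 0 1 :=
      ContinuousOn.intervalIntegrable (continuousOn_const.mul
        (hg.continuousOn.comp (f := fun t : ℝ => (t : ℂ) * w) (by fun_prop) hmem))
    simpa [segInt] using intervalIntegral.integral_eq_sub_of_hasDerivAt hd hint
  exact ((hG z hz).sub_const (G 0)).congr_of_eventuallyEq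
    (eventually_of_mem (Metric.isOpen_ball.mem_nhds hz) heq)

lemma re_one_add_div_one_sub_pos {w : ℂ} (hw : ‖w‖ < 1) : 0 < ((1 + w) / (1 - w)).re := by
  have hne : 1 - w ≠ 0 := sub_ne_zero.2 fun h => by simp [← h] at hw
  have hsq : normSq w < 1 := by
    rw [normSq_eq_norm_sq]
    exact pow_lt_one₀ (norm_nonneg w) hw two_ne_zero
  have hre : ((1 + w) / (1 - w)).re = (1 - normSq w) / normSq (1 - w) := by
    rw [div_re, normSq_apply w]
    simp
    ring
  rw [hre]
  exact div_pos (sub_pos.2 hsq) (normSq_pos.2 hne)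

lemma one_add_ne_zero_of_norm_lt_one {w : ℂ} (hw : ‖w‖ < 1) : 1 + w ≠ 0 := fun h => by
  simp [eq_neg_of_add_eq_zero_right h] at hw

lemma one_sub_ne_zero_of_norm_lt_one {w : ℂ} (hw : ‖w‖ < 1) : 1 - w ≠ 0 := by
  simpa [sub_eq_add_neg] using one_add_ne_zero_of_norm_lt_one (w := -w) (by simpa using hw)

/-- The conformal map of the unit disk onto the plane slit along four horizontal half-lines. -/
def fourSlitMap (α : ℝ) (z : ℂ) : ℂ :=
  (1 / 2 : ℂ) * (Real.sin α : ℂ) ^ 2 * Complex.log ((1 + z) / (1 - z)) +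
    z * (Real.cos α : ℂ) ^ 2 / (1 + z ^ 2)

lemma norm_sq_lt_one {z : ℂ} (hz : ‖z‖ < 1) : ‖z ^ 2‖ < 1 := by
  rw [norm_pow]
  exact pow_lt_one₀ (norm_nonneg z) hz two_ne_zero

lemma hasDerivAt_fourSlitMap (α : ℝ) {z : ℂ} (hz : ‖z‖ < 1) :
    HasDerivAt (fourSlitMap α) ((1 + z ^ 2)⁻¹ *
      ((Real.sin α ^ 2 : ℝ) * ((1 + z ^ 2) / (1 - z ^ 2)) +
        (Real.cos α ^ 2 : ℝ) * ((1 + -z ^ 2) / (1 - -z ^ 2)))) z := by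
  have h1 := one_add_ne_zero_of_norm_lt_one hz
  have h2 := one_sub_ne_zero_of_norm_lt_one hz
  have h3 := one_add_ne_zero_of_norm_lt_one (norm_sq_lt_one hz)
  have h4 : 1 - z ^ 2 ≠ 0 := one_sub_ne_zero_of_norm_lt_one (norm_sq_lt_one hz)
  have hid := hasDerivAt_id z
  have hlog := (((hid.const_add 1).div (hid.const_sub 1) h2).clog
    (Or.inl (re_one_add_div_one_sub_pos hz))).const_mul ((1 / 2 : ℂ) * (Real.sin α : ℂ) ^ 2)
  have hrat := (hid.mul_const ((Real.cos α : ℂ) ^ 2)).div ((hid.pow 2).const_add 1) h3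
  refine (hlog.add hrat).congr_deriv ?_
  have h5 : 1 - z ^ 2 = (1 - z) * (1 + z) := by ring
  simp only [id, Pi.div_apply, Pi.pow_apply, sub_neg_eq_add, ofReal_pow]
  rw [h5]
  field_simp
  ring

lemma re_one_add_sq_mul_deriv_fourSlitMap_pos {α : ℝ} (hα : 0 < Real.cos α) {z : ℂ}
    (hz : ‖z‖ < 1) : 0 < ((1 + z ^ 2) * deriv (fourSlitMap α) z).re := by
  have h3 := one_add_ne_zero_of_norm_lt_one (norm_sq_lt_one hz)
  rw [(hasDerivAt_fourSlitMap α hz).deriv, mul_inv_cancel_left₀ h3, add_re, re_ofReal_mul,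
    re_ofReal_mul]
  have hp := re_one_add_div_one_sub_pos (norm_sq_lt_one hz)
  have hm := re_one_add_div_one_sub_pos (w := -z ^ 2) (by rw [norm_neg]; exact norm_sq_lt_one hz)
  positivity

/-- The vertical strip `|re w| < π / 4`, which `tan` maps onto the unit disk. -/
def tanStrip : Set ℂ := {w | w.re ∈ Ioo (-(π / 4)) (π / 4)}

lemma cos_two_mul_re_pos {w : ℂ} (hw : w ∈ tanStrip) : 0 < Real.cos (2 * w.re) :=
  Real.cos_pos_of_mem_Ioo ⟨by linarith [hw.1], by linarith [hw.2]⟩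

lemma normSq_sin_lt_normSq_cos {w : ℂ} (hw : w ∈ tanStrip) :
    normSq (sin w) < normSq (cos w) := by
  have hpos := cos_two_mul_re_pos hw
  have hs : sin w = ↑(Real.sin w.re * Real.cosh w.im) + ↑(Real.cos w.re * Real.sinh w.im) * I := by
    rw [sin_eq]; push_cast; ring
  have hc : cos w = ↑(Real.cos w.re * Real.cosh w.im) + ↑(-(Real.sin w.re * Real.sinh w.im)) * I := by
    rw [cos_eq]; push_cast; ring
  rw [hs, hc, normSq_add_mul_I, normSq_add_mul_I]
  rw [Real.cos_two_mul'] at hpos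
  nlinarith [Real.cosh_sq w.im]

lemma cos_ne_zero_of_mem_tanStrip {w : ℂ} (hw : w ∈ tanStrip) : cos w ≠ 0 :=
  normSq_pos.1 ((normSq_nonneg _).trans_lt (normSq_sin_lt_normSq_cos hw))

lemma norm_tan_lt_one {w : ℂ} (hw : w ∈ tanStrip) : ‖tan w‖ < 1 := by
  have hc := norm_pos_iff.2 (cos_ne_zero_of_mem_tanStrip hw)
  rw [tan, norm_div, div_lt_one hc, ← sq_lt_sq₀ (norm_nonneg _) (norm_nonneg _),
    ← normSq_eq_norm_sq, ← normSq_eq_norm_sq]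
  exact normSq_sin_lt_normSq_cos hw

lemma arctan_mem_tanStrip {z : ℂ} (hz : ‖z‖ < 1) : arctan z ∈ tanStrip := by
  have hpos := re_one_add_div_one_sub_pos (w := z * I) (by simpa using hz)
  have harg := abs_lt.1 (abs_arg_lt_pi_div_two_iff.2 (Or.inl hpos))
  have hre : (arctan z).re = arg ((1 + z * I) / (1 - z * I)) / 2 := by
    rw [arctan, ← log_im]
    simp [mul_re]
    ring
  constructor <;> rw [hre] <;> linarith [harg.1, harg.2]

lemma tan_arctan_of_norm_lt_one {z : ℂ} (hz : ‖z‖ < 1) : tan (arctan z) = z :=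
  tan_arctan (fun h => by simp [h] at hz) fun h => by simp [h] at hz

lemma one_add_tan_sq {w : ℂ} (hw : cos w ≠ 0) : 1 + tan w ^ 2 = 1 / cos w ^ 2 := by
  rw [tan, eq_div_iff (pow_ne_zero 2 hw), add_mul, div_pow, div_mul_cancel₀ _ (pow_ne_zero 2 hw),
    one_mul, cos_sq_add_sin_sq]

lemma image_tan_tanStrip : tan '' tanStrip = unitDisk := by
  ext z
  simp only [unitDisk, mem_ball_zero_iff]
  exact ⟨fun ⟨w, hw, h⟩ => h ▸ norm_tan_lt_one hw,
    fun hz => ⟨arctan z, arctan_mem_tanStrip hz, tan_arctan_of_norm_lt_one hz⟩⟩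

lemma hasDerivAt_fourSlitMap_tan (α : ℝ) {w : ℂ} (hw : w ∈ tanStrip) :
    HasDerivAt (fourSlitMap α ∘ tan)
      ((1 + tan w ^ 2) * deriv (fourSlitMap α) (tan w)) w := by
  have hc := cos_ne_zero_of_mem_tanStrip hw
  rw [one_add_tan_sq hc, mul_comm]
  exact (hasDerivAt_fourSlitMap α (norm_tan_lt_one hw)).differentiableAt.hasDerivAt.comp w
    (hasDerivAt_tan hc)

lemma injOn_fourSlitMap {α : ℝ} (hα : 0 < Real.cos α) : InjOn (fourSlitMap α) unitDisk := by
  have hconv : Convex ℝ tanStrip := (convex_Ioo _ _).linear_preimage reLm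
  have hinj : InjOn (fourSlitMap α ∘ tan) tanStrip :=
    injOn_of_re_deriv_pos hconv (fun w hw => hasDerivAt_fourSlitMap_tan α hw) fun w hw =>
      re_one_add_sq_mul_deriv_fourSlitMap_pos hα (norm_tan_lt_one hw)
  rw [← image_tan_tanStrip]
  exact hinj.image_of_comp

lemma im_fourSlitMap_tan (α : ℝ) {x : ℝ} (hx : x ∈ Ioo (-(π / 4)) (π / 4)) (y : ℝ) :
    (fourSlitMap α (tan (x + y * I))).im =
      Real.sin α ^ 2 / 2 * arg ((1 + tan (x + y * I)) / (1 - tan (x + y * I))) +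
        Real.cos α ^ 2 / 2 * Real.cos (2 * x) * Real.sinh (2 * y) := by
  have hw : (x + y * I : ℂ) ∈ tanStrip := by simpa [tanStrip] using hx
  have hc := cos_ne_zero_of_mem_tanStrip hw
  have h1 : tan (x + y * I : ℂ) * (Real.cos α : ℂ) ^ 2 / (1 + tan (x + y * I) ^ 2) =
      ((Real.cos α ^ 2 / 2 : ℝ) : ℂ) * sin (2 * (x + y * I)) := by
    rw [one_add_tan_sq hc, tan, sin_two_mul]
    push_cast
    field_simp
  have h2 : (1 / 2 : ℂ) * (Real.sin α : ℂ) ^ 2 = ((Real.sin α ^ 2 / 2 : ℝ) : ℂ) := by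
    push_cast; ring
  have h3 : (sin (2 * (x + y * I) : ℂ)).im = Real.cos (2 * x) * Real.sinh (2 * y) := by
    have h : sin (2 * (x + y * I) : ℂ) = ↑(Real.sin (2 * x) * Real.cosh (2 * y)) +
        ↑(Real.cos (2 * x) * Real.sinh (2 * y)) * I := by
      rw [mul_add, ← mul_assoc, sin_add_mul_I]
      push_cast
      ring
    rw [h]
    simp only [add_im, ofReal_im, im_ofReal_mul, I_im, mul_one, zero_add]
  rw [fourSlitMap, h1, h2, add_im, im_ofReal_mul, im_ofReal_mul, log_im, h3, mul_assoc]

lemma isCHD_image_fourSlitMap {α : ℝ} (hα : 0 < Real.cos α) :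
    IsCHD (fourSlitMap α '' unitDisk) := by
  rw [← image_tan_tanStrip, ← image_comp]
  have hcoef : ∀ x ∈ Ioo (-(π / 4)) (π / 4), 0 < Real.cos α ^ 2 / 2 * Real.cos (2 * x) :=
    fun x hx => mul_pos (by positivity) (cos_two_mul_re_pos (w := x) hx)
  have hbound (z : ℂ) : |Real.sin α ^ 2 / 2 * arg z| ≤ Real.sin α ^ 2 / 2 * π := by
    rw [abs_mul, abs_of_nonneg (by positivity)]
    exact mul_le_mul_of_nonneg_left (abs_arg_le_pi z) (by positivity)
  refine isCHD_image_strip (fun w hw => hasDerivAt_fourSlitMap_tan α hw)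
    (fun w hw => re_one_add_sq_mul_deriv_fourSlitMap_pos hα (norm_tan_lt_one hw))
    (fun x hx => ?_) fun x hx => ?_
  · simp only [Function.comp_apply, im_fourSlitMap_tan α hx]
    exact tendsto_atTop_add_left_of_le _ _ (fun y => (abs_le.1 (hbound _)).1)
      ((Real.sinhOrderIso.tendsto_atTop.comp
        (tendsto_id.const_mul_atTop two_pos)).const_mul_atTop (hcoef x hx))
  · simp only [Function.comp_apply, im_fourSlitMap_tan α hx]
    exact tendsto_atBot_add_left_of_ge _ _ (fun y => (abs_le.1 (hbound _)).2)
      ((Real.sinhOrderIso.tendsto_atBot.comp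
        (tendsto_id.const_mul_atBot two_pos)).const_mul_atBot (hcoef x hx))

theorem nehari_slit_mapping_shear_univalent_CHD
    (α : ℝ) (hα : α ∈ Set.Ioo 0 (Real.pi / 2)) (n : ℕ) (hn : 0 < n) :
    let φ : ℂ → ℂ := fun z =>
      (1 / 2 : ℂ) * (Real.sin α : ℂ) ^ 2 * Complex.log ((1 + z) / (1 - z)) +
        z * (Real.cos α : ℂ) ^ 2 / (1 + z ^ 2)
    let f : ℂ → ℂ := fun z =>
      2 * (((segInt (fun ζ => deriv φ ζ / (1 - ζ ^ n)) z).re : ℝ) : ℂ) -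
        (starRingEnd ℂ) (φ z)
    Set.InjOn f unitDisk ∧ IsCHD (f '' unitDisk) := by
  intro φ f
  have hcos : 0 < Real.cos α := Real.cos_pos_of_mem_Ioo ⟨by linarith [hα.1, Real.pi_pos], hα.2⟩
  have hnorm : ∀ z ∈ unitDisk, ‖z‖ < 1 := fun z hz => mem_ball_zero_iff.1 hz
  have hpow : ∀ z ∈ unitDisk, ‖z ^ n‖ < 1 := fun z hz => by
    rw [norm_pow]
    exact pow_lt_one₀ (norm_nonneg z) (hnorm z hz) hn.ne'
  have hφ : DifferentiableOn ℂ φ unitDisk := fun z hz =>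
    (hasDerivAt_fourSlitMap α (hnorm z hz)).differentiableAt.differentiableWithinAt
  have hh : DifferentiableOn ℂ (fun ζ => deriv φ ζ / (1 - ζ ^ n)) unitDisk :=
    (hφ.deriv Metric.isOpen_ball).div (by fun_prop)
      fun z hz => one_sub_ne_zero_of_norm_lt_one (hpow z hz)
  refine injOn_and_isCHD_of_shear (φ := φ)
    (k := fun z => 2 * segInt (fun ζ => deriv φ ζ / (1 - ζ ^ n)) z - φ z) Metric.isOpen_ball hφ
    (injOn_fourSlitMap hcos) (fun z hz h0 => ?_) (isCHD_image_fourSlitMap hcos)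
    (fun z hz => ⟨(1 + z ^ n) / (1 - z ^ n), re_one_add_div_one_sub_pos (hpow z hz), ?_⟩)
    (fun z hz => by simp [f]) (fun z hz => by simp [f])
  · have hpos := re_one_add_sq_mul_deriv_fourSlitMap_pos hcos (hnorm z hz)
    rw [show deriv (fourSlitMap α) z = 0 from h0, mul_zero, zero_re] at hpos
    exact hpos.false
  · have hφz := (hφ.differentiableAt (Metric.isOpen_ball.mem_nhds hz)).hasDerivAt
    refine (((hasDerivAt_segInt hh hz).const_mul 2).sub hφz).congr_deriv ?_
    have hne := one_sub_ne_zero_of_norm_lt_one (hpow z hz)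
    field_simp
    ring
end
end

section
/- Let n ≥ 1 be an integer. For every z ∈ 𝔻, ∫₀^z ζ^{2n} (1−ζⁿ)^{−1−2/n} (1+ζⁿ)^{−1} dζ = (z^{2n+1}/(2n+1)) · F₁(2+1/n, 1+2/n, 1; 3+1/n; zⁿ, −zⁿ), where the integral is along the segment from 0 to z and (1−ζⁿ)^{−1−2/n} denotes the principal power. -/
open Complex Set
open scoped Real

noncomputable section

/-- The defining product of `poch` may be extended by one factor on either end. -/
lemma poch_mul_add (a : ℂ) (m : ℕ) : poch a m * (a + m) = a * poch (a + 1) m := by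
  have h : poch a (m + 1) = poch a m * (a + m) := Finset.prod_range_succ _ _
  rw [← h, poch, Finset.prod_range_succ', mul_comm]
  simp only [poch, Nat.cast_zero, add_zero, Nat.cast_add, Nat.cast_one]
  congr 1
  exact Finset.prod_congr rfl fun i _ => by ring

lemma poch_ne_zero {a : ℂ} (ha : 0 < a.re) (m : ℕ) : poch a m ≠ 0 := by
  refine Finset.prod_ne_zero_iff.mpr fun i _ h => ?_
  have h' := congrArg Complex.re h
  simp only [add_re, natCast_re, zero_re] at h'
  have : (0 : ℝ) ≤ i := i.cast_nonneg
  linarith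

lemma poch_one (m : ℕ) : poch 1 m = m.factorial := by
  rw [poch, ← Finset.prod_range_add_one_eq_factorial]
  push_cast
  exact Finset.prod_congr rfl fun i _ => by ring

lemma poch_eq_ascPochhammer_eval (b : ℂ) (k : ℕ) : poch b k = (ascPochhammer ℂ k).eval b := by
  induction k with
  | zero => simp [poch]
  | succ k ih =>
    rw [ascPochhammer_succ_eval, ← ih]
    exact Finset.prod_range_succ _ _

lemma ringChoose_eq_poch_div (b : ℂ) (k : ℕ) :
    Ring.choose (b + k - 1) k = poch b k / k.factorial := by
  have h := Ring.factorial_nsmul_multichoose_eq_ascPochhammer b k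
  rw [Polynomial.ascPochhammer_smeval_eq_eval, ← poch_eq_ascPochhammer_eval, nsmul_eq_mul] at h
  rw [Ring.choose, eq_div_iff (by exact_mod_cast k.factorial_ne_zero), mul_comm, ← h]
  congr 2
  ring

/-- The binomial series with Pochhammer coefficients. -/
lemma hasSum_poch_div_factorial_mul_pow (b : ℂ) {w : ℂ} (hw : ‖w‖ < 1) :
    HasSum (fun k : ℕ => poch b k / k.factorial * w ^ k) ((1 - w) ^ (-b)) := by
  have h := (Complex.one_div_one_sub_cpow_hasFPowerSeriesOnBall_zero b).hasSum (y := w)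
    (by simpa [enorm_eq_nnnorm, ← NNReal.coe_lt_one] using hw)
  simpa [FormalMultilinearSeries.ofScalars_apply_eq, ringChoose_eq_poch_div, cpow_neg,
    mul_comm] using h

lemma hasSum_neg_pow {w : ℂ} (hw : ‖w‖ < 1) :
    HasSum (fun l : ℕ => (-w) ^ l) (1 + w)⁻¹ := by
  simpa using hasSum_geometric_of_norm_lt_one (ξ := -w) (by simpa using hw)

lemma summable_norm_poch_mul_pow (b : ℂ) {r : ℝ} (hr0 : 0 ≤ r) (hr : r < 1) :
    Summable fun p : ℕ × ℕ => ‖poch b p.1 / p.1.factorial‖ * r ^ p.1 * r ^ p.2 := by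
  have hr' : ‖(r : ℂ)‖ < 1 := by simpa [abs_of_nonneg hr0] using hr
  have h₁ := (hasSum_poch_div_factorial_mul_pow b hr').summable.norm
  simp only [norm_mul _ (_ ^ _), norm_pow, norm_real, Real.norm_of_nonneg hr0] at h₁
  exact h₁.mul_of_nonneg (summable_geometric_of_lt_one hr0 hr)
    (fun _ => by positivity) (fun _ => by positivity)

/-- The product expansion of `(1 - w) ^ (-b) * (1 + w)⁻¹`. -/
lemma hasSum_cpow_mul_inv (b : ℂ) {w : ℂ} (hw : ‖w‖ < 1) :
    HasSum (fun p : ℕ × ℕ => poch b p.1 / p.1.factorial * w ^ p.1 * (-w) ^ p.2)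
      ((1 - w) ^ (-b) * (1 + w)⁻¹) := by
  refine (hasSum_poch_div_factorial_mul_pow b hw).mul (hasSum_neg_pow hw) ?_
  refine ((summable_norm_poch_mul_pow b (norm_nonneg w) hw).congr fun p => ?_).of_norm
  simp

/-- Termwise integration of the product expansion along the segment from `0` to `z`. -/
lemma hasSum_segInt (n : ℕ) (hn : 1 ≤ n) (b : ℂ) {z : ℂ} (hz : ‖z‖ < 1) :
    HasSum (fun p : ℕ × ℕ => z ^ (2 * n + 1) * (poch b p.1 / p.1.factorial) *
        (z ^ n) ^ p.1 * (-z ^ n) ^ p.2 / (2 * n + 1 + n * (p.1 + p.2 : ℕ)))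
      (segInt (fun ζ => ζ ^ (2 * n) * (1 - ζ ^ n) ^ (-b) * (1 + ζ ^ n)⁻¹) z) := by
  have hzn : ‖z‖ ^ n < 1 := pow_lt_one₀ (norm_nonneg _) hz (by omega)
  have hsum := summable_norm_poch_mul_pow b (pow_nonneg (norm_nonneg z) n) hzn
  have hnorm : ∀ t ∈ Set.uIoc (0 : ℝ) 1, ‖(t : ℂ) * z‖ ≤ ‖z‖ := fun t ht => by
    rw [uIoc_of_le zero_le_one] at ht
    rw [norm_mul, norm_real, Real.norm_of_nonneg ht.1.le]
    exact mul_le_of_le_one_left (norm_nonneg _) ht.2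
  have key := intervalIntegral.hasSum_integral_of_dominated_convergence
    (μ := MeasureTheory.volume) (a := 0) (b := 1)
    (F := fun (p : ℕ × ℕ) (t : ℝ) => z * (((t : ℂ) * z) ^ (2 * n) *
      (poch b p.1 / p.1.factorial * (((t : ℂ) * z) ^ n) ^ p.1 * (-((t : ℂ) * z) ^ n) ^ p.2)))
    (f := fun t : ℝ => z * (((t : ℂ) * z) ^ (2 * n) * (1 - ((t : ℂ) * z) ^ n) ^ (-b) *
      (1 + ((t : ℂ) * z) ^ n)⁻¹))
    (fun p _ => ‖poch b p.1 / p.1.factorial‖ * (‖z‖ ^ n) ^ p.1 * (‖z‖ ^ n) ^ p.2)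
    (fun p => Continuous.aestronglyMeasurable (by fun_prop))
    (fun p => .of_forall fun t ht => ?_)
    (.of_forall fun _ _ => hsum)
    intervalIntegrable_const
    (.of_forall fun t ht => ?_)
  · refine Eq.subst (motive := fun g : ℕ × ℕ → ℂ => HasSum g _) (funext fun p => ?_) key
    symm
    have hd : (2 * n + 1 + n * (p.1 + p.2 : ℕ) : ℂ) ≠ 0 := by
      exact_mod_cast (by positivity : 2 * n + 1 + n * (p.1 + p.2) ≠ 0)
    have hF : ∀ t : ℝ, z * (((t : ℂ) * z) ^ (2 * n) * (poch b p.1 / p.1.factorial *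
        (((t : ℂ) * z) ^ n) ^ p.1 * (-((t : ℂ) * z) ^ n) ^ p.2)) =
        z ^ (2 * n + 1) * (poch b p.1 / p.1.factorial) * (z ^ n) ^ p.1 * (-z ^ n) ^ p.2 *
          ((t ^ (2 * n + n * (p.1 + p.2)) : ℝ) : ℂ) := fun t => by
      rw [neg_pow, neg_pow (z ^ n)]
      push_cast
      ring
    simp only [hF]
    rw [intervalIntegral.integral_const_mul, intervalIntegral.integral_ofReal, integral_pow,
      div_eq_mul_inv]
    push_cast
    simp
    left
    ring
  · have h := hnorm t ht
    have h1 : ‖(t : ℂ) * z‖ ^ (2 * n) ≤ 1 := pow_le_one₀ (norm_nonneg _) (h.trans hz.le)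
    rw [norm_mul, norm_mul, norm_mul, norm_mul, norm_pow, norm_pow, norm_pow, norm_pow, norm_neg,
      norm_pow, ← mul_assoc]
    refine (mul_le_of_le_one_left (by positivity)
      (mul_le_one₀ hz.le (by positivity) h1)).trans ?_
    gcongr
  · have hw : ‖((t : ℂ) * z) ^ n‖ < 1 := by
      rw [norm_pow]
      exact (pow_le_pow_left₀ (norm_nonneg _) (hnorm t ht) n).trans_lt hzn
    have h := ((hasSum_cpow_mul_inv b hw).mul_left (((t : ℂ) * z) ^ (2 * n))).mul_left z
    rwa [← mul_assoc (_ ^ (2 * n))] at h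

theorem polygon_shear_g_appell
    (n : ℕ) (hn : 1 ≤ n) (z : ℂ) (hz : z ∈ unitDisk) :
    segInt (fun ζ => ζ ^ (2 * n) * (1 - ζ ^ n) ^ (-1 - 2 / (n : ℂ)) * (1 + ζ ^ n)⁻¹) z =
      z ^ (2 * n + 1) / (2 * (n : ℂ) + 1) *
        appellF1 (2 + 1 / (n : ℂ)) (1 + 2 / (n : ℂ)) 1 (3 + 1 / (n : ℂ)) (z ^ n) (-z ^ n) := by
  have hz' : ‖z‖ < 1 := by simpa [unitDisk] using hz
  have hn0 : (n : ℂ) ≠ 0 := by exact_mod_cast (by omega : n ≠ 0)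
  have hs := hasSum_segInt n hn (1 + 2 / (n : ℂ)) hz'
  have hexp : (-1 - 2 / (n : ℂ)) = -(1 + 2 / (n : ℂ)) := by ring
  rw [hexp, ← hs.tsum_eq, hs.summable.tsum_prod, appellF1, ← tsum_mul_left]
  refine tsum_congr fun k => ?_
  rw [← tsum_mul_left]
  refine tsum_congr fun l => ?_
  have ha := poch_mul_add (2 + 1 / (n : ℂ)) (k + l)
  rw [show (2 + 1 / (n : ℂ) + 1) = 3 + 1 / n by ring] at ha
  have hc : poch (3 + 1 / (n : ℂ)) (k + l) ≠ 0 := by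
    refine poch_ne_zero ?_ _
    have : (1 / (n : ℂ)) = ((1 / n : ℝ) : ℂ) := by push_cast; rfl
    rw [this, add_re, ofReal_re]
    norm_num
    positivity
  have hk : (k.factorial : ℂ) ≠ 0 := by exact_mod_cast k.factorial_ne_zero
  have hl : (l.factorial : ℂ) ≠ 0 := by exact_mod_cast l.factorial_ne_zero
  have h2 : (2 * n + 1 : ℂ) ≠ 0 := by exact_mod_cast (by omega : 2 * n + 1 ≠ 0)
  have hd : (2 * n + 1 + n * (k + l : ℕ) : ℂ) ≠ 0 := by
    exact_mod_cast (by positivity : 2 * n + 1 + n * (k + l) ≠ 0)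
  have hratio : poch (2 + 1 / (n : ℂ)) (k + l) * (2 * n + 1 + n * (k + l : ℕ)) =
      (2 * n + 1) * poch (3 + 1 / (n : ℂ)) (k + l) := by
    calc _ = n * (poch (2 + 1 / (n : ℂ)) (k + l) * (2 + 1 / n + (k + l : ℕ))) := by
          field_simp
      _ = _ := by rw [ha]; field_simp
  rw [poch_one]
  generalize poch (2 + 1 / (n : ℂ)) (k + l) = A at *
  generalize poch (3 + 1 / (n : ℂ)) (k + l) = C at *
  generalize poch (1 + 2 / (n : ℂ)) k = B at *
  generalize (2 * n + 1 + n * (k + l : ℕ) : ℂ) = D at *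
  obtain rfl : A = (2 * n + 1) * C / D := by rw [eq_div_iff hd, hratio]
  field_simp
end
end

section
/- Let n ≥ 1 be an odd integer. For every z ∈ 𝔻, ∫₀^z (1−ζⁿ)^{−2/n} (1−ζ²)^{−1} dζ = Σ_{k=0}^{n−1} (z^{2k+1}/(2k+1)) · F₁((2k+1)/n, 1+2/n, 1; 1+(2k+1)/n; zⁿ, −zⁿ), where the integral is along the segment from 0 to z and (1−ζⁿ)^{−2/n} denotes the principal power. -/
open Complex Set
open scoped Real

noncomputable section

theorem poch_div_factorial_eq_choose (b : ℂ) (k : ℕ) :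
    poch b k / (k.factorial : ℂ) = Ring.choose (b + k - 1) k := by
  have hp : (ascPochhammer ℂ k).eval b = poch b k := by
    induction k with
    | zero => simp [poch]
    | succ k ih => rw [ascPochhammer_succ_eval, ih, poch, poch, Finset.prod_range_succ]
  have h := Ring.factorial_nsmul_multichoose_eq_ascPochhammer b k
  rw [Polynomial.ascPochhammer_smeval_eq_eval, hp, Ring.multichoose_eq, nsmul_eq_mul] at h
  rw [div_eq_iff (by exact_mod_cast k.factorial_ne_zero), mul_comm, h]

theorem one_sub_cpow_neg_hasSum (b : ℂ) {w : ℂ} (hw : ‖w‖ < 1) :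
    HasSum (fun k : ℕ => poch b k / (k.factorial : ℂ) * w ^ k) ((1 - w) ^ (-b)) := by
  have h := (Complex.one_div_one_sub_cpow_hasFPowerSeriesOnBall_zero b).hasSum (y := w)
    (by simpa [mem_eball_zero_iff, enorm_eq_nnnorm, ← NNReal.coe_lt_coe] using hw)
  simpa [FormalMultilinearSeries.ofScalars_apply_eq, poch_div_factorial_eq_choose,
    cpow_neg, smul_eq_mul, mul_comm] using h

theorem poch_div_factorial_mul_pow_summable_norm (b : ℂ) {w : ℂ} (hw : ‖w‖ < 1) :
    Summable (fun k : ℕ => ‖poch b k / (k.factorial : ℂ) * w ^ k‖) :=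
  (one_sub_cpow_neg_hasSum b hw).summable.norm

theorem poch_ne_zero_s15 {c : ℂ} (hc : 0 < c.re) (m : ℕ) : poch c m ≠ 0 := by
  refine Finset.prod_ne_zero_iff.mpr fun i _ h => ?_
  have := congrArg Complex.re h
  simp at this
  linarith [i.cast_nonneg (α := ℝ)]

theorem poch_div_poch_one_add {a : ℂ} (ha : 0 < a.re) (m : ℕ) :
    poch a m / poch (1 + a) m = a / (a + m) := by
  have h : poch a m * (a + m) = a * poch (1 + a) m := by
    rw [poch, ← Finset.prod_range_succ, Finset.prod_range_succ', poch, mul_comm]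
    simp [add_comm, add_left_comm]
  have h1 : poch (1 + a) m ≠ 0 := poch_ne_zero_s15 (by simp; positivity) m
  have h2 : a + m ≠ 0 := fun h => by
    have := congrArg Complex.re h
    simp at this
    linarith [m.cast_nonneg (α := ℝ)]
  rw [div_eq_div_iff h1 h2, h]

theorem poch_one_s15 (l : ℕ) : poch 1 l = (l.factorial : ℂ) := by
  rw [poch, ← Finset.prod_range_add_one_eq_factorial]
  push_cast
  simp [add_comm]

theorem segInt_hasSum {ι : Type*} [Countable ι] {z : ℂ} {f : ℂ → ℂ} (c : ι → ℂ) (m : ι → ℕ)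
    (hc : Summable fun i => ‖c i * z ^ m i‖)
    (hf : ∀ t ∈ Icc (0 : ℝ) 1, HasSum (fun i => c i * (t * z) ^ m i) (f (t * z))) :
    HasSum (fun i => c i * z ^ (m i + 1) / (m i + 1)) (segInt f z) := by
  have h := intervalIntegral.hasSum_integral_of_dominated_convergence (μ := MeasureTheory.volume)
    (a := 0) (b := 1) (F := fun i (t : ℝ) => z * (c i * (t * z) ^ m i))
    (f := fun t : ℝ => z * f (t * z)) (fun i _ => ‖z‖ * ‖c i * z ^ m i‖)
    (fun i => (by fun_prop :
      Continuous fun t : ℝ => z * (c i * (t * z) ^ m i)).aestronglyMeasurable)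
    (fun i => .of_forall fun t ht => ?_) (.of_forall fun _ _ => hc.mul_left _)
    intervalIntegrable_const (.of_forall fun t ht => (hf t ?_).mul_left z)
  · have hpow (i : ι) : ∀ t : ℝ, z * (c i * (t * z) ^ m i) = (c i * z ^ (m i + 1)) * ((t ^ m i : ℝ) : ℂ) := by
      intro t; push_cast; ring
    have hint (i : ι) : ∫ t in (0 : ℝ)..1, z * (c i * (t * z) ^ m i) =
        c i * z ^ (m i + 1) / (m i + 1) := by
      simp only [hpow, intervalIntegral.integral_const_mul, intervalIntegral.integral_ofReal,
        integral_pow]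
      simp [div_eq_mul_inv]
    simp only [hint] at h
    exact h
  · rw [uIoc_of_le zero_le_one] at ht
    simp only [norm_mul, norm_pow, mul_pow, norm_real, Real.norm_eq_abs, abs_of_pos ht.1]
    gcongr
    exact mul_le_of_le_one_left (by positivity) (pow_le_one₀ ht.1.le ht.2)
  · rw [uIoc_of_le zero_le_one] at ht
    exact Ioc_subset_Icc_self ht

theorem norm_ofReal_mul_pow_lt_one {n : ℕ} (hn : n ≠ 0) {z : ℂ} (hz : ‖z‖ < 1) {t : ℝ}
    (ht : t ∈ Icc (0 : ℝ) 1) : ‖((t : ℂ) * z) ^ n‖ < 1 := by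
  rw [norm_pow]
  refine pow_lt_one₀ (norm_nonneg _) ?_ hn
  rw [norm_mul, norm_real, Real.norm_eq_abs, abs_of_nonneg ht.1]
  exact (mul_le_of_le_one_left (norm_nonneg _) ht.2).trans_lt hz

theorem one_sub_mem_slitPlane {w : ℂ} (hw : ‖w‖ < 1) : 1 - w ∈ slitPlane :=
  .inl (by simpa using (re_le_norm w).trans_lt hw)

theorem segInt_pow_mul_one_sub_cpow {n : ℕ} (hn : n ≠ 0) (j : ℕ) (b : ℂ) {z : ℂ} (hz : ‖z‖ < 1) :
    segInt (fun ζ => ζ ^ j * ((1 - ζ ^ n) ^ (-b) * (1 + ζ ^ n)⁻¹)) z =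
      z ^ (j + 1) / (j + 1) *
        appellF1 ((j + 1) / n) b 1 (1 + (j + 1) / n) (z ^ n) (-z ^ n) := by
  have hgeom {w : ℂ} (hw : ‖w‖ < 1) : Summable fun l : ℕ => ‖(-w) ^ l‖ :=
    summable_norm_geometric_of_norm_lt_one (by simpa using hw)
  have hprod (p : ℕ × ℕ) (w : ℂ) :
      poch b p.1 / (p.1.factorial : ℂ) * (-1) ^ p.2 * w ^ (j + n * (p.1 + p.2)) =
        w ^ j * (poch b p.1 / (p.1.factorial : ℂ) * (w ^ n) ^ p.1 * (-(w ^ n)) ^ p.2) := by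
    rw [neg_pow (w ^ n)]; ring
  have hzn : ‖z ^ n‖ < 1 := by simpa using norm_ofReal_mul_pow_lt_one hn hz ⟨zero_le_one, le_rfl⟩
  have key := segInt_hasSum (z := z)
    (f := fun ζ => ζ ^ j * ((1 - ζ ^ n) ^ (-b) * (1 + ζ ^ n)⁻¹))
    (fun p : ℕ × ℕ => poch b p.1 / (p.1.factorial : ℂ) * (-1) ^ p.2)
    (fun p => j + n * (p.1 + p.2)) ?_ ?_
  · rw [appellF1, ← key.tsum_eq, key.summable.tsum_prod, ← tsum_mul_left]
    refine tsum_congr fun k => ?_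
    rw [← tsum_mul_left]
    refine tsum_congr fun l => ?_
    have hn' : (n : ℂ) ≠ 0 := by exact_mod_cast hn
    have ha : 0 < (((j : ℂ) + 1) / n).re := by
      have : ((j : ℂ) + 1) / n = (((j + 1) / n : ℝ) : ℂ) := by push_cast; rfl
      rw [this, ofReal_re]; positivity
    have h := poch_div_poch_one_add ha (k + l)
    have h1 : (j : ℂ) + 1 ≠ 0 := by exact_mod_cast j.succ_ne_zero
    have h2 : (j : ℂ) + n * (k + l) + 1 ≠ 0 := by exact_mod_cast (j + n * (k + l)).succ_ne_zero
    have h3 : ((j : ℂ) + 1) / n / ((j + 1) / n + (k + l : ℕ)) =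
        (j + 1) / (j + n * (k + l) + 1) := by
      have h4 : ((j : ℂ) + 1) / n + (k + l : ℕ) = (j + n * (k + l) + 1) / n := by
        push_cast; field_simp; ring
      rw [h4]; field_simp
    rw [h3] at h
    have hl : (l.factorial : ℂ) ≠ 0 := by exact_mod_cast l.factorial_ne_zero
    rw [poch_one_s15, neg_pow (z ^ n)]
    calc _ = z ^ (j + 1) / (j + 1) * (((j + 1) / (j + n * (k + l) + 1)) *
          (poch b k / (k.factorial : ℂ)) * (z ^ n) ^ k * ((-1) ^ l * (z ^ n) ^ l)) := by
            push_cast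
            generalize poch b k / (k.factorial : ℂ) = B
            field_simp
            ring
      _ = _ := by
            rw [← h]
            generalize (k.factorial : ℂ) = K
            field_simp
  · simp_rw [hprod, norm_mul (z ^ j)]
    exact ((poch_div_factorial_mul_pow_summable_norm b hzn).mul_norm (hgeom hzn)).mul_left _
  · intro t ht
    have hw := norm_ofReal_mul_pow_lt_one hn hz ht
    simp_rw [hprod]
    refine HasSum.mul_left _ ?_
    have hg := hasSum_geometric_of_norm_lt_one (ξ := -((t * z) ^ n)) (by simpa using hw)
    rw [sub_neg_eq_add] at hg
    have hs := summable_mul_of_summable_norm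
      (poch_div_factorial_mul_pow_summable_norm b hw) (hgeom hw)
    exact (one_sub_cpow_neg_hasSum b hw).mul hg hs

theorem one_sub_cpow_mul_inv_one_sub_sq {n : ℕ} (s : ℂ) {ζ : ℂ} (hn : ‖ζ ^ n‖ < 1)
    (h2 : ‖ζ ^ 2‖ < 1) :
    (1 - ζ ^ n) ^ (-s) * (1 - ζ ^ 2)⁻¹ =
      ∑ k ∈ Finset.range n, ζ ^ (2 * k) * ((1 - ζ ^ n) ^ (-(1 + s)) * (1 + ζ ^ n)⁻¹) := by
  have h1 : 1 - ζ ^ n ≠ 0 := slitPlane_ne_zero (one_sub_mem_slitPlane hn)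
  have h3 : 1 - ζ ^ 2 ≠ 0 := slitPlane_ne_zero (one_sub_mem_slitPlane h2)
  have h4 : 1 + ζ ^ n ≠ 0 := by
    simpa using slitPlane_ne_zero (one_sub_mem_slitPlane (w := -ζ ^ n) (by simpa using hn))
  have hs : (1 - ζ ^ n) ^ (-s) = (1 - ζ ^ n) * (1 - ζ ^ n) ^ (-(1 + s)) := by
    rw [show -s = 1 + -(1 + s) by ring, cpow_add _ _ h1, cpow_one]
  have hg := mul_neg_geom_sum (ζ ^ 2) n
  simp_rw [← pow_mul] at hg
  rw [← Finset.sum_mul, hs, pow_mul' ζ 2 n] at *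
  field_simp
  linear_combination -(1 - ζ ^ n) ^ (-(1 + s)) * hg

theorem polygon_shear_z2_h_appell
    (n : ℕ) (hodd : Odd n) (hn : 1 ≤ n) (z : ℂ) (hz : z ∈ unitDisk) :
    segInt (fun ζ => (1 - ζ ^ n) ^ (-(2 / (n : ℂ))) * (1 - ζ ^ 2)⁻¹) z =
      ∑ k ∈ Finset.range n, z ^ (2 * k + 1) / (2 * (k : ℂ) + 1) *
        appellF1 ((2 * (k : ℂ) + 1) / (n : ℂ)) (1 + 2 / (n : ℂ)) 1
          (1 + (2 * (k : ℂ) + 1) / (n : ℂ)) (z ^ n) (-z ^ n) := by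
  have hz' : ‖z‖ < 1 := by simpa [unitDisk] using hz
  have hn0 : n ≠ 0 := by lia
  have hterm (k : ℕ) := segInt_pow_mul_one_sub_cpow hn0 (2 * k) (1 + 2 / (n : ℂ)) hz'
  push_cast at hterm
  simp_rw [← hterm, segInt]
  rw [← intervalIntegral.integral_finsetSum]
  · refine intervalIntegral.integral_congr fun t ht => ?_
    rw [uIcc_of_le zero_le_one] at ht
    simp only [← Finset.mul_sum]
    rw [one_sub_cpow_mul_inv_one_sub_sq _ (norm_ofReal_mul_pow_lt_one hn0 hz' ht)
      (norm_ofReal_mul_pow_lt_one two_ne_zero hz' ht)]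
  · refine fun k _ => ContinuousOn.intervalIntegrable fun t ht => ?_
    rw [uIcc_of_le zero_le_one] at ht
    have hw := norm_ofReal_mul_pow_lt_one hn0 hz' ht
    have h1 := one_sub_mem_slitPlane hw
    have h2 : 1 + (t * z) ^ n ≠ 0 := by
      simpa using slitPlane_ne_zero (one_sub_mem_slitPlane (w := -(t * z) ^ n) (by simpa using hw))
    refine ContinuousAt.continuousWithinAt ?_
    refine continuousAt_const.mul (ContinuousAt.mul (by fun_prop) (ContinuousAt.mul ?_ ?_))
    · exact ContinuousAt.cpow (by fun_prop) continuousAt_const h1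
    · exact ContinuousAt.inv₀ (by fun_prop) h2
end
end

section
/- Let n ≥ 1 be an odd integer. For every z ∈ 𝔻, ∫₀^z ζ² (1−ζⁿ)^{−2/n} (1−ζ²)^{−1} dζ = Σ_{k=1}^{n} (z^{2k+1}/(2k+1)) · F₁((2k+1)/n, 1+2/n, 1; 1+(2k+1)/n; zⁿ, −zⁿ), where the integral is along the segment from 0 to z and (1−ζⁿ)^{−2/n} denotes the principal power. -/
open Complex Set
open scoped Real

noncomputable section

theorem poch_eq_eval_ascPochhammer (a : ℂ) (m : ℕ) : poch a m = (ascPochhammer ℂ m).eval a := by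
  induction m with
  | zero => simp [poch]
  | succ m ih =>
    rw [ascPochhammer_succ_eval, ← ih]
    simp [poch, Finset.prod_range_succ]

theorem choose_add_sub_one_eq_poch_div (b : ℂ) (m : ℕ) :
    Ring.choose (b + m - 1) m = poch b m / m.factorial := by
  have h := Ring.factorial_nsmul_multichoose_eq_ascPochhammer b m
  rw [Polynomial.ascPochhammer_smeval_eq_eval, ← poch_eq_eval_ascPochhammer, nsmul_eq_mul] at h
  have h' : Ring.choose (b + m - 1) m = Ring.multichoose b m := by
    rw [Ring.choose]
    congr 1
    ring
  rw [h', eq_div_iff (by exact_mod_cast m.factorial_ne_zero), mul_comm, h]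

theorem hasSum_one_sub_cpow_neg (b : ℂ) {x : ℂ} (hx : ‖x‖ < 1) :
    HasSum (fun m : ℕ => poch b m / m.factorial * x ^ m) ((1 - x) ^ (-b)) := by
  have h := (one_div_one_sub_cpow_hasFPowerSeriesOnBall_zero b).hasSum (y := x) (by
    simpa [← ofReal_norm] using hx)
  simpa [choose_add_sub_one_eq_poch_div, cpow_neg, mul_comm] using h

theorem summable_norm_poch_div_factorial_mul_pow (b : ℂ) {x : ℂ} (hx : ‖x‖ < 1) :
    Summable (fun m : ℕ => ‖poch b m / m.factorial * x ^ m‖) := by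
  have h := one_div_one_sub_cpow_hasFPowerSeriesOnBall_zero b
  have h' := FormalMultilinearSeries.summable_norm_apply _ (x := x)
    (Metric.eball_subset_eball h.r_le (by simpa [← ofReal_norm] using hx))
  simpa [choose_add_sub_one_eq_poch_div, mul_comm] using h'

theorem integral_pow_eq_poch_ratio (p : ℕ) {n : ℕ} (hn : 1 ≤ n) (m : ℕ) :
    ∫ t in (0 : ℝ)..1, (t : ℂ) ^ (p + n * m) =
      1 / ((p : ℂ) + 1) * (poch (((p : ℂ) + 1) / n) m / poch (1 + ((p : ℂ) + 1) / n) m) := by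
  have hn0 : (n : ℂ) ≠ 0 := by exact_mod_cast (by lia : n ≠ 0)
  have hre : 0 < (((p : ℂ) + 1) / n).re := by
    rw [show ((p : ℂ) + 1) / n = (((p + 1 : ℝ) / n : ℝ) : ℂ) by push_cast; ring, ofReal_re]
    positivity
  have hmono (j : ℕ) : ∫ t in (0 : ℝ)..1, (t : ℂ) ^ j = 1 / ((j : ℂ) + 1) := by
    simp_rw [← ofReal_pow]
    rw [intervalIntegral.integral_ofReal, integral_pow]
    simp
  have h₁ : (p : ℂ) + 1 ≠ 0 := by exact_mod_cast p.succ_ne_zero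
  have h₂ : (p : ℂ) + 1 + n * m ≠ 0 := by
    exact_mod_cast (by lia : p + 1 + n * m ≠ 0)
  rw [hmono, poch_div_poch_one_add hre,
    show ((p : ℂ) + 1) / n + m = (p + 1 + n * m) / n by field_simp]
  push_cast
  rw [show (p : ℂ) + n * m + 1 = p + 1 + n * m by ring]
  field_simp

/-- The Euler-type integral representation of `appellF1` at `c = a + 1`. -/
theorem integral_pow_mul_cpow_mul_cpow_eq_appellF1 (p : ℕ) {n : ℕ} (hn : 1 ≤ n) (b₁ b₂ : ℂ)
    {x y : ℂ} (hx : ‖x‖ < 1) (hy : ‖y‖ < 1) :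
    ∫ t in (0 : ℝ)..1,
        (t : ℂ) ^ p * (1 - (t : ℂ) ^ n * x) ^ (-b₁) * (1 - (t : ℂ) ^ n * y) ^ (-b₂) =
      1 / ((p : ℂ) + 1) *
        appellF1 (((p : ℂ) + 1) / n) b₁ b₂ (1 + ((p : ℂ) + 1) / n) x y := by
  let f : ℕ × ℕ → ℂ := fun q =>
    (poch b₁ q.1 / q.1.factorial * x ^ q.1) * (poch b₂ q.2 / q.2.factorial * y ^ q.2)
  have hf : Summable (fun q => ‖f q‖) :=
    Summable.mul_norm (f := fun m : ℕ => poch b₁ m / m.factorial * x ^ m)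
      (g := fun m : ℕ => poch b₂ m / m.factorial * y ^ m)
      (summable_norm_poch_div_factorial_mul_pow b₁ hx)
      (summable_norm_poch_div_factorial_mul_pow b₂ hy)
  have hpow {t : ℝ} (ht : t ∈ uIoc (0 : ℝ) 1) (m : ℕ) : ‖(t : ℂ) ^ m‖ ≤ 1 := by
    rw [uIoc_of_le zero_le_one] at ht
    rw [norm_pow, norm_real, Real.norm_of_nonneg ht.1.le]
    exact pow_le_one₀ ht.1.le ht.2
  have hmul {t : ℝ} (ht : t ∈ uIoc (0 : ℝ) 1) {w : ℂ} (hw : ‖w‖ < 1) : ‖(t : ℂ) ^ n * w‖ < 1 := by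
    rw [norm_mul]
    exact (mul_le_of_le_one_left (norm_nonneg w) (hpow ht n)).trans_lt hw
  have hsum : HasSum (fun q => ∫ t in (0 : ℝ)..1, f q * (t : ℂ) ^ (p + n * (q.1 + q.2)))
      (∫ t in (0 : ℝ)..1,
        (t : ℂ) ^ p * (1 - (t : ℂ) ^ n * x) ^ (-b₁) * (1 - (t : ℂ) ^ n * y) ^ (-b₂)) := by
    refine intervalIntegral.hasSum_integral_of_dominated_convergence
      (F := fun q t => f q * (t : ℂ) ^ (p + n * (q.1 + q.2))) (fun q _ => ‖f q‖)
      (fun q => ?_) ?_ (.of_forall fun _ _ => hf) intervalIntegrable_const ?_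
    · have : Continuous fun t : ℝ => f q * (t : ℂ) ^ (p + n * (q.1 + q.2)) := by fun_prop
      exact this.aestronglyMeasurable
    · refine fun q => .of_forall fun t ht => ?_
      rw [norm_mul]
      exact mul_le_of_le_one_right (norm_nonneg _) (hpow ht _)
    · refine .of_forall fun t ht => ?_
      have h := ((hasSum_one_sub_cpow_neg b₁ (hmul ht hx)).mul
        (hasSum_one_sub_cpow_neg b₂ (hmul ht hy)) (summable_mul_of_summable_norm
          (f := fun m : ℕ => poch b₁ m / m.factorial * ((t : ℂ) ^ n * x) ^ m)
          (g := fun m : ℕ => poch b₂ m / m.factorial * ((t : ℂ) ^ n * y) ^ m)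
          (summable_norm_poch_div_factorial_mul_pow b₁ (hmul ht hx))
          (summable_norm_poch_div_factorial_mul_pow b₂ (hmul ht hy)))).mul_left ((t : ℂ) ^ p)
      rw [← mul_assoc] at h
      refine h.congr_fun fun q => ?_
      simp only [f]
      ring
  rw [← hsum.tsum_eq, hsum.summable.tsum_prod]
  simp_rw [intervalIntegral.integral_const_mul, integral_pow_eq_poch_ratio p hn]
  rw [appellF1, ← tsum_mul_left]
  refine tsum_congr fun k => ?_
  rw [← tsum_mul_left]
  refine tsum_congr fun l => ?_
  simp only [f, div_eq_mul_inv, mul_inv]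
  ring

theorem sq_mul_cpow_mul_inv_eq_sum {n : ℕ} (hn : 1 ≤ n) {w : ℂ} (hw : ‖w‖ < 1) (b : ℂ) :
    w ^ 2 * (1 - w ^ n) ^ (-b) * (1 - w ^ 2)⁻¹ =
      ∑ k ∈ Finset.Icc 1 n, w ^ (2 * k) * (1 - w ^ n) ^ (-(1 + b)) * (1 + w ^ n) ^ (-1 : ℂ) := by
  have hpow {m : ℕ} (hm : m ≠ 0) : ‖w ^ m‖ < 1 := by
    rw [norm_pow]
    exact pow_lt_one₀ (norm_nonneg w) hw hm
  have h₁ : 1 - w ^ n ≠ 0 := fun h => by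
    have := hpow (m := n) (by lia)
    rw [← sub_eq_zero.mp h] at this
    simp at this
  have h₂ : 1 + w ^ n ≠ 0 := fun h => by
    have := hpow (m := n) (by lia)
    rw [← neg_eq_of_add_eq_zero_right h] at this
    simp at this
  have h₃ : 1 - w ^ 2 ≠ 0 := fun h => by
    have := hpow two_ne_zero
    rw [← sub_eq_zero.mp h] at this
    simp at this
  have hgeom : (∑ k ∈ Finset.Icc 1 n, w ^ (2 * k)) * (1 - w ^ 2) =
      w ^ 2 * ((1 - w ^ n) * (1 + w ^ n)) := by
    have : ∑ k ∈ Finset.Icc 1 n, w ^ (2 * k) = w ^ 2 * ∑ k ∈ Finset.range n, (w ^ 2) ^ k := by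
      rw [← Finset.Ico_add_one_right_eq_Icc, Finset.sum_Ico_eq_sum_range, Finset.mul_sum]
      exact Finset.sum_congr rfl fun k _ => by ring
    rw [this, mul_assoc, geom_sum_mul_neg]
    ring
  rw [← Finset.sum_mul, ← Finset.sum_mul, cpow_neg_one, neg_add, cpow_add _ _ h₁, cpow_neg_one]
  field_simp
  linear_combination -(1 - w ^ n) ^ (-b) * hgeom

theorem polygon_shear_z2_g_appell
    (n : ℕ) (hodd : Odd n) (hn : 1 ≤ n) (z : ℂ) (hz : z ∈ unitDisk) :
    segInt (fun ζ => ζ ^ 2 * (1 - ζ ^ n) ^ (-(2 / (n : ℂ))) * (1 - ζ ^ 2)⁻¹) z =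
      ∑ k ∈ Finset.Icc 1 n, z ^ (2 * k + 1) / (2 * (k : ℂ) + 1) *
        appellF1 ((2 * (k : ℂ) + 1) / (n : ℂ)) (1 + 2 / (n : ℂ)) 1
          (1 + (2 * (k : ℂ) + 1) / (n : ℂ)) (z ^ n) (-z ^ n) := by
  have hz' : ‖z‖ < 1 := by simpa [unitDisk] using hz
  have hzn : ‖z ^ n‖ < 1 := by
    rw [norm_pow]
    exact pow_lt_one₀ (norm_nonneg z) hz' (by lia)
  have hzn' : ‖-z ^ n‖ < 1 := by rwa [norm_neg]
  have hlt {w : ℂ} (hw : ‖w‖ < 1) {t : ℝ} (ht : t ∈ uIcc (0 : ℝ) 1) : ‖(t : ℂ) ^ n * w‖ < 1 := by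
    rw [uIcc_of_le zero_le_one] at ht
    rw [norm_mul, norm_pow, norm_real, Real.norm_of_nonneg ht.1]
    exact (mul_le_of_le_one_left (norm_nonneg w) (pow_le_one₀ ht.1 ht.2)).trans_lt hw
  have hslit {w : ℂ} (hw : ‖w‖ < 1) : 1 - w ∈ slitPlane := by
    simpa [sub_eq_add_neg] using mem_slitPlane_of_norm_lt_one (z := -w) (by rwa [norm_neg])
  have hsplit : segInt (fun ζ => ζ ^ 2 * (1 - ζ ^ n) ^ (-(2 / (n : ℂ))) * (1 - ζ ^ 2)⁻¹) z =
      ∫ t in (0 : ℝ)..1, ∑ k ∈ Finset.Icc 1 n, z ^ (2 * k + 1) * ((t : ℂ) ^ (2 * k) *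
        (1 - (t : ℂ) ^ n * z ^ n) ^ (-(1 + 2 / (n : ℂ))) *
          (1 - (t : ℂ) ^ n * (-z ^ n)) ^ (-1 : ℂ)) := by
    refine intervalIntegral.integral_congr fun t ht => ?_
    have hw : ‖(t : ℂ) * z‖ < 1 := by
      rw [uIcc_of_le zero_le_one] at ht
      rw [norm_mul, norm_real, Real.norm_of_nonneg ht.1]
      exact (mul_le_of_le_one_left (norm_nonneg z) ht.2).trans_lt hz'
    simp only []
    rw [sq_mul_cpow_mul_inv_eq_sum hn hw, Finset.mul_sum]
    refine Finset.sum_congr rfl fun k _ => ?_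
    rw [mul_pow, mul_pow, mul_neg, sub_neg_eq_add]
    ring
  rw [hsplit, intervalIntegral.integral_finsetSum]
  · refine Finset.sum_congr rfl fun k _ => ?_
    rw [intervalIntegral.integral_const_mul,
      integral_pow_mul_cpow_mul_cpow_eq_appellF1 (2 * k) hn _ _ hzn hzn']
    push_cast
    ring
  · refine fun k _ => ContinuousOn.intervalIntegrable ?_
    refine continuousOn_const.mul (((by fun_prop : Continuous fun t : ℝ =>
      (t : ℂ) ^ (2 * k)).continuousOn.mul ?_).mul ?_)
    · exact ContinuousOn.cpow_const (by fun_prop) fun t ht => hslit (hlt hzn ht)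
    · exact ContinuousOn.cpow_const (by fun_prop) fun t ht => hslit (hlt hzn' ht)
end
end
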